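/- arXiv:1101.3642 — 4 statements merged into one kernel-verified Lean document; each statement's English description precedes it below -/
import Mathlib

section
/- (Acyclicity Lemma) Let (R, m) be a local Cohen-Macaulay ring of dimension d, and let 0 → X^0 → X^1 → ... → X^{d-1} → X^d → X^{d+1} → ... be a complex of finitely generated R-modules with i-th homology H^i. Assume depth_R X^i ≥ d - i for all i ≥ 0, H^i = 0 for all i ≥ d, and each H^i for i ≥ 0 has finite length over R. Then the complex is exact. -/
open CategoryTheory IsLocalRing
open scoped Classical

universe u

noncomputable section

/-- The depth of a module over a Noetherian local ring: the supremum of lengths of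
regular sequences contained in the maximal ideal (with `depth 0 = ⊤`). -/
def rdepth (R : Type u) [CommRing R] [IsLocalRing R]
    (M : Type u) [AddCommGroup M] [Module R M] : ℕ∞ :=
  if Subsingleton M then ⊤
  else sSup {n : ℕ∞ | ∃ rs : List R, (∀ r ∈ rs, r ∈ IsLocalRing.maximalIdeal R) ∧
    RingTheory.Sequence.IsRegular M rs ∧ (rs.length : ℕ∞) = n}

/-- Vanishing of `Ext^i` over an arbitrary ring. -/
def extVanish (A : Type u) [Ring A] (i : ℕ) (X Y : ModuleCat.{u} A) : Prop :=
  Subsingleton (((Ext ℤ (ModuleCat.{u} A) i).obj (Opposite.op X)).obj Y)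

/-- Projective dimension, via vanishing of Ext. -/
def projDim (A : Type u) [Ring A] (X : Type u) [AddCommGroup X] [Module A X] : ℕ∞ :=
  sInf {n : ℕ∞ | ∀ i : ℕ, n < (i : ℕ∞) → ∀ Y : ModuleCat.{u} A,
    extVanish A i (ModuleCat.of A X) Y}

/-- Global dimension of a ring, via vanishing of Ext. -/
def globalDim (A : Type u) [Ring A] : ℕ∞ :=
  sInf {n : ℕ∞ | ∀ i : ℕ, n < (i : ℕ∞) → ∀ X Y : ModuleCat.{u} A, extVanish A i X Y}

/-- A Noetherian local ring is Cohen-Macaulay if its depth equals its Krull dimension. -/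
def IsCMLocalRing (R : Type u) [CommRing R] [IsLocalRing R] : Prop :=
  (rdepth R R : WithBot ℕ∞) = ringKrullDim R

/-- A ring is Cohen-Macaulay if all its localizations at primes are Cohen-Macaulay. -/
def IsCMRing (R : Type u) [CommRing R] : Prop :=
  ∀ (p : Ideal R) (hp : p.IsPrime),
    letI := hp
    IsCMLocalRing (Localization.AtPrime p)

/-- A canonical module of a local ring: a maximal Cohen-Macaulay module of finite injective
dimension whose endomorphism ring is `R`. -/
structure IsCanonicalModule (R : Type u) [CommRing R] [IsLocalRing R]
    (w : Type u) [AddCommGroup w] [Module R w] : Prop where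
  finite : Module.Finite R w
  mcm : (rdepth R w : WithBot ℕ∞) = ringKrullDim R
  finInjDim : ∃ n : ℕ, ∀ i : ℕ, n < i → ∀ X : ModuleCat.{u} R,
    extVanish R i X (ModuleCat.of R w)
  endIso : Nonempty (Module.End R w ≃+* R)

/-- A canonical module of a (not necessarily local) ring: a finitely generated module
which localizes to a canonical module at every maximal ideal. -/
def IsGlobalCanonicalModule (R : Type u) [CommRing R]
    (w : Type u) [AddCommGroup w] [Module R w] : Prop :=
  Module.Finite R w ∧
  ∀ (m : Ideal R) (hm : m.IsMaximal),
    letI := hm.isPrime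
    IsCanonicalModule (Localization.AtPrime m) (LocalizedModule m.primeCompl w)

/-- The height of a prime ideal. -/
def primeHeight {R : Type u} [CommRing R] (p : Ideal R) (hp : p.IsPrime) : ℕ∞ :=
  Order.height (⟨p, hp⟩ : PrimeSpectrum R)

/-- All maximal ideals have the same height. -/
def EquiCodimensional (R : Type u) [CommRing R] : Prop :=
  ∀ (m₁ m₂ : Ideal R) (h₁ : m₁.IsMaximal) (h₂ : m₂.IsMaximal),
    primeHeight m₁ h₁.isPrime = primeHeight m₂ h₂.isPrime

/-- A non-singular `R`-order: a module-finite `R`-algebra which is a maximal Cohen-Macaulay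
`R`-module and such that `gl.dim Λ_p = dim R_p` for all primes `p` of `R`. -/
structure IsNonsingularOrder (R : Type u) [CommRing R]
    (L : Type u) [Ring L] [Algebra R L] : Prop where
  finite : Module.Finite R L
  mcm : ∀ (p : Ideal R) (hp : p.IsPrime),
    letI := hp
    (rdepth (Localization.AtPrime p) (LocalizedModule p.primeCompl L) : WithBot ℕ∞)
      = ringKrullDim (Localization.AtPrime p)
  gldim : ∀ (p : Ideal R) (hp : p.IsPrime),
    letI := hp
    (globalDim (LocalizedModule p.primeCompl L) : WithBot ℕ∞)
      = ringKrullDim (Localization.AtPrime p)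

/-- `Hom_R(M,N)` is a left module over `End_R(M)^op` via precomposition.
(The paper's convention `fg = f then g` makes its `End_R(M)` the opposite of Mathlib's.) -/
instance endOpModuleHom {R M N : Type u} [CommRing R] [AddCommGroup M] [Module R M]
    [AddCommGroup N] [Module R N] :
    Module (Module.End R M)ᵐᵒᵖ (M →ₗ[R] N) where
  smul a g := g ∘ₗ a.unop
  one_smul g := LinearMap.ext fun _ => rfl
  mul_smul a b g := LinearMap.ext fun _ => rfl
  smul_zero a := LinearMap.ext fun _ => rfl
  smul_add a g h := LinearMap.ext fun _ => rfl
  add_smul a b g := LinearMap.ext fun x => g.map_add _ _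
  zero_smul g := LinearMap.ext fun x => g.map_zero

/-- A noncommutative crepant resolution: `End_R(M)` for a nonzero finitely generated
reflexive `R`-module `M` such that `End_R(M)` is a non-singular `R`-order. -/
def IsNCCR (R : Type u) [CommRing R] (M : Type u) [AddCommGroup M] [Module R M] : Prop :=
  Nontrivial M ∧ Module.Finite R M ∧ Module.IsReflexive R M ∧
    IsNonsingularOrder R (Module.End R M)ᵐᵒᵖ

/-- `X ∈ add M`: `X` is a direct summand of a finite direct sum of copies of `M`. -/
def InAdd (A : Type u) [Ring A] (M : Type u) [AddCommGroup M] [Module A M]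
    (X : Type u) [AddCommGroup X] [Module A X] : Prop :=
  ∃ (n : ℕ) (s : X →ₗ[A] (Fin n → M)) (r : (Fin n → M) →ₗ[A] X),
    r ∘ₗ s = LinearMap.id

end

open Abelian in
/-- If the depth of `M` exceeds `j`, then `Ext^j(k, M) = 0` for the residue field `k`. -/
theorem subsingleton_ext_residue_of_lt_rdepth {R : Type u} [CommRing R] [IsLocalRing R]
    [IsNoetherianRing R] (M : Type u) [AddCommGroup M] [Module R M] [Module.Finite R M]
    {j : ℕ} (h : (j : ℕ∞) < rdepth R M) :
    Subsingleton (Ext (ModuleCat.of R (R ⧸ maximalIdeal R)) (ModuleCat.of R M) j) := by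
  by_cases hM : Subsingleton M
  · exact AddCommGrpCat.subsingleton_of_isZero <|
      Functor.map_isZero (extFunctorObj (ModuleCat.of R (R ⧸ maximalIdeal R)) j)
        (ModuleCat.isZero_of_subsingleton (ModuleCat.of R M))
  · rw [rdepth, if_neg hM, lt_sSup_iff] at h
    obtain ⟨_, ⟨rs, hrs, hreg, rfl⟩, hlt⟩ := h
    have : Nontrivial M := not_subsingleton_iff_nontrivial.mp hM
    refine ModuleCat.subsingleton_ext_of_exists_isRegular (maximalIdeal R)
      (ModuleCat.of R (R ⧸ maximalIdeal R)) ?_ (ModuleCat.of R M) ?_ rs hrs hreg j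
      (by exact_mod_cast hlt)
    · rw [Module.support_eq_zeroLocus, Ideal.annihilator_quotient]
    · exact (Submodule.top_ne_ideal_smul_of_le_jacobson_annihilator
        (maximalIdeal_le_jacobson _)).symm.lt_top

/-- A module of finite length with no nonzero map from the residue field is zero. -/
theorem IsFiniteLength.subsingleton_of_subsingleton_linearMap_residue {R : Type u} [CommRing R]
    [IsLocalRing R] {M : Type u} [AddCommGroup M] [Module R M] (hM : IsFiniteLength R M)
    (h : Subsingleton ((R ⧸ maximalIdeal R) →ₗ[R] M)) : Subsingleton M := by
  by_contra hne
  rw [not_subsingleton_iff_nontrivial] at hne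
  have := (isFiniteLength_iff_isNoetherian_isArtinian.mp hM).2
  obtain ⟨S, hS⟩ : ∃ S : Submodule R M, IsSimpleModule R S := by
    simpa [isSimpleModule_iff_isAtom] using IsAtomic.exists_atom (Submodule R M)
  obtain ⟨I, hI, ⟨e⟩⟩ := isSimpleModule_iff_quot_maximal.mp hS
  obtain rfl := eq_maximalIdeal hI
  have hzero : S.subtype ∘ₗ e.symm.toLinearMap = 0 := Subsingleton.elim _ _
  have := hS.nontrivial
  obtain ⟨x, hx⟩ := exists_ne (0 : S)
  exact hx (by simpa using LinearMap.congr_fun hzero (e x))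

/-- The short exact sequence `0 → ker g → M → range g → 0` attached to a linear map. -/
def kerRangeShortComplex {R : Type u} [CommRing R] {M N : Type u} [AddCommGroup M] [Module R M]
    [AddCommGroup N] [Module R N] (g : M →ₗ[R] N) : ShortComplex (ModuleCat.{u} R) :=
  ShortComplex.mk (ModuleCat.ofHom (LinearMap.ker g).subtype)
    (ModuleCat.ofHom g.rangeRestrict) (by ext x; exact x.2)

theorem kerRangeShortComplex_shortExact {R : Type u} [CommRing R] {M N : Type u}
    [AddCommGroup M] [Module R M] [AddCommGroup N] [Module R N] (g : M →ₗ[R] N) :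
    (kerRangeShortComplex g).ShortExact where
  exact := (ShortComplex.ShortExact.moduleCat_exact_iff_function_exact _).mpr fun x => by
    change g.rangeRestrict x = 0 ↔ x ∈ Set.range (LinearMap.ker g).subtype
    exact ⟨fun hx => ⟨⟨x, congrArg Subtype.val hx⟩, rfl⟩,
      by rintro ⟨y, rfl⟩; exact Subtype.ext y.2⟩
  mono_f := (ModuleCat.mono_iff_injective _).mpr (Submodule.injective_subtype _)
  epi_g := (ModuleCat.epi_iff_surjective _).mpr g.surjective_rangeRestrict

open Abelian in
theorem subsingleton_ext_of_shortExact {R : Type u} [CommRing R] (K : ModuleCat.{u} R)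
    {S : ShortComplex (ModuleCat.{u} R)} (hS : S.ShortExact) (j : ℕ)
    (h₂ : Subsingleton (Ext K S.X₂ j)) (h₁ : Subsingleton (Ext K S.X₁ (j + 1))) :
    Subsingleton (Ext K S.X₃ j) :=
  AddCommGrpCat.subsingleton_of_isZero <| ShortComplex.Exact.isZero_of_both_zeros
    (Ext.covariant_sequence_exact₃' K hS j (j + 1) rfl)
    ((AddCommGrpCat.isZero_of_iff_subsingleton.mpr h₂).eq_zero_of_src _)
    ((AddCommGrpCat.isZero_of_iff_subsingleton.mpr h₁).eq_zero_of_tgt _)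

open Abelian in
/-- If `B ≤ Z ≤ M` with `Z / B` of finite length, `Hom(k, M) = 0` and `Ext^1(k, B) = 0`,
then `B = Z`. -/
theorem eq_of_isFiniteLength_quotient_of_subsingleton_ext {R : Type u} [CommRing R]
    [IsLocalRing R] {M : Type u} [AddCommGroup M] [Module R M] {B Z : Submodule R M}
    (hBZ : B ≤ Z) (hfl : IsFiniteLength R (Z ⧸ B.comap Z.subtype))
    (hM : Subsingleton (Ext (ModuleCat.of R (R ⧸ maximalIdeal R)) (ModuleCat.of R M) 0))
    (hB : Subsingleton (Ext (ModuleCat.of R (R ⧸ maximalIdeal R)) (ModuleCat.of R B) 1)) :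
    B = Z := by
  have hZ : Subsingleton (Ext (ModuleCat.of R (R ⧸ maximalIdeal R)) (ModuleCat.of R Z) 0) := by
    have hM' := (Ext.addEquiv₀.trans ModuleCat.homAddEquiv).symm.subsingleton_congr.mpr hM
    refine (Ext.addEquiv₀.trans ModuleCat.homAddEquiv).subsingleton_congr.mpr ⟨fun a b => ?_⟩
    exact (LinearMap.cancel_left Z.injective_subtype).mp (Subsingleton.elim _ _)
  let S : ShortComplex (ModuleCat.{u} R) :=
    ShortComplex.mk (ModuleCat.ofHom (Submodule.inclusion hBZ))
      (ModuleCat.ofHom (B.comap Z.subtype).mkQ)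
      (by ext x; exact (Submodule.Quotient.mk_eq_zero _).mpr x.2)
  have hS : S.ShortExact :=
    { exact := (ShortComplex.ShortExact.moduleCat_exact_iff_function_exact _).mpr fun x => by
        change (B.comap Z.subtype).mkQ x = 0 ↔ x ∈ Set.range (Submodule.inclusion hBZ)
        rw [Submodule.mkQ_apply, Submodule.Quotient.mk_eq_zero]
        exact ⟨fun hx => ⟨⟨x, hx⟩, rfl⟩, by rintro ⟨y, rfl⟩; exact y.2⟩
      mono_f := (ModuleCat.mono_iff_injective _).mpr (Submodule.inclusion_injective hBZ)
      epi_g := (ModuleCat.epi_iff_surjective _).mpr (Submodule.mkQ_surjective _) }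
  have hH := subsingleton_ext_of_shortExact (ModuleCat.of R (R ⧸ maximalIdeal R)) hS 0 hZ hB
  have := hfl.subsingleton_of_subsingleton_linearMap_residue
    ((Ext.addEquiv₀.trans ModuleCat.homAddEquiv).subsingleton_congr.mp hH)
  rw [Submodule.Quotient.subsingleton_iff, Submodule.comap_subtype_eq_top] at this
  exact le_antisymm hBZ this

/-- The coboundaries of a cochain complex of modules indexed by `ℕ`. -/
def coboundaries {R : Type u} [CommRing R] {X : ℕ → Type u} [∀ i, AddCommGroup (X i)]
    [∀ i, Module R (X i)] (f : ∀ i, X i →ₗ[R] X (i + 1)) : ∀ i, Submodule R (X i)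
  | 0 => ⊥
  | i + 1 => LinearMap.range (f i)

/-- the Acyclicity Lemma. -/
theorem stmt4 (R : Type u) [CommRing R] [IsLocalRing R] [IsNoetherianRing R]
    (hCM : IsCMLocalRing R) (d : ℕ) (hd : ringKrullDim R = d)
    (X : ℕ → Type u) [∀ i, AddCommGroup (X i)] [∀ i, Module R (X i)]
    [∀ i, Module.Finite R (X i)]
    (f : ∀ i, X i →ₗ[R] X (i + 1))
    (hc : ∀ i, (f (i + 1)) ∘ₗ (f i) = 0)
    (hdepth : ∀ i, ((d - i : ℕ) : ℕ∞) ≤ rdepth R (X i))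
    (hvan0 : d = 0 → LinearMap.ker (f 0) = ⊥)
    (hvan : ∀ i, d ≤ i + 1 → LinearMap.range (f i) = LinearMap.ker (f (i + 1)))
    (hfl0 : IsFiniteLength R (LinearMap.ker (f 0)))
    (hfl : ∀ i, IsFiniteLength R
      ((LinearMap.ker (f (i + 1))) ⧸
        ((LinearMap.range (f i)).comap (LinearMap.ker (f (i + 1))).subtype))) :
    LinearMap.ker (f 0) = ⊥ ∧
      ∀ i, LinearMap.range (f i) = LinearMap.ker (f (i + 1)) := by
  let K := ModuleCat.of R (R ⧸ maximalIdeal R)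
  have hBZ : ∀ i, coboundaries f i ≤ LinearMap.ker (f i)
    | 0 => bot_le
    | i + 1 => LinearMap.range_le_ker_iff.mpr (hc i)
  have hfl' : ∀ i, IsFiniteLength R
      (LinearMap.ker (f i) ⧸ (coboundaries f i).comap (LinearMap.ker (f i)).subtype)
    | 0 => hfl0.of_surjective (Submodule.mkQ_surjective _)
    | i + 1 => hfl i
  have hvan' : ∀ i, d ≤ i → coboundaries f i = LinearMap.ker (f i)
    | 0, h => (hvan0 (Nat.le_zero.mp h)).symm
    | i + 1, h => hvan i h
  have hX : ∀ i j, i + j < d → Subsingleton (Abelian.Ext K (ModuleCat.of R (X i)) j) :=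
    fun i j hij => subsingleton_ext_residue_of_lt_rdepth (X i) <|
      lt_of_lt_of_le (by exact_mod_cast (by omega : j < d - i)) (hdepth i)
  have exact_of_ext : ∀ i, (∀ j, i + j < d + 1 →
      Subsingleton (Abelian.Ext K (ModuleCat.of R (coboundaries f i)) j)) →
      coboundaries f i = LinearMap.ker (f i) := fun i h => by
    rcases le_or_gt d i with hi | hi
    · exact hvan' i hi
    · exact eq_of_isFiniteLength_quotient_of_subsingleton_ext (hBZ i) (hfl' i)
        (hX i 0 hi) (h 1 (by omega))
  have hB : ∀ i j, i + j < d + 1 →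
      Subsingleton (Abelian.Ext K (ModuleCat.of R (coboundaries f i)) j) := by
    intro i
    induction i with
    | zero =>
      intro j _
      have : Subsingleton (coboundaries f 0) :=
        inferInstanceAs (Subsingleton (⊥ : Submodule R (X 0)))
      refine subsingleton_ext_residue_of_lt_rdepth (coboundaries f 0) ?_
      rw [rdepth, if_pos this]
      exact ENat.natCast_lt_top j
    | succ i ih =>
      intro j hj
      have hker := exact_of_ext i ih
      refine subsingleton_ext_of_shortExact K (kerRangeShortComplex_shortExact (f i)) j
        (hX i j (by omega)) ?_
      have := ih (j + 1) (by omega)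
      rwa [hker] at this
  have hexact := fun i => exact_of_ext i (hB i)
  exact ⟨(hexact 0).symm, fun i => hexact (i + 1)⟩
end

section
/- Let (R, m) be a local Cohen-Macaulay ring of dimension d, and let 0 → X^0 → X^1 → ... be a complex of finitely generated R-modules with homology H^i. Assume depth_R X^i ≥ d - i for all i ≥ 0, H^i = 0 for all i ≥ d, and for every i ≥ 0 and every prime ideal p of R with height p ≤ i, the localization H^i_p = 0. If R admits a canonical module ω_R, then the complex is exact. -/
open CategoryTheory IsLocalRing
open scoped Classical

universe u

/-- Multiplication by `r` on `N` induces multiplication by `r` on `Ext N M j`. -/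
lemma ext_mk₀_smul_id_comp {R : Type u} [CommRing R] {N M : ModuleCat.{u} R} {j : ℕ} (r : R)
    (y : Abelian.Ext N M j) : (Abelian.Ext.mk₀ (r • 𝟙 N)).comp y (zero_add j) = r • y := by
  simp [Abelian.Ext.mk₀_smul]

/-- For a regular element `x` on `N`, vanishing of `Ext (N ⧸ xN) M (j + 1)` forces
`Ext N M j` to vanish, by Nakayama's lemma. -/
lemma subsingleton_ext_of_quotSMulTop {R : Type u} [CommRing R] [IsLocalRing R]
    [IsNoetherianRing R] (N M : ModuleCat.{u} R) [Module.Finite R N] [Module.Finite R M]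
    {x : R} (hx : x ∈ maximalIdeal R) (hreg : IsSMulRegular N x) (j : ℕ)
    (h : Subsingleton (Abelian.Ext (ModuleCat.of R (QuotSMulTop x N)) M (j + 1))) :
    Subsingleton (Abelian.Ext N M j) := by
  have key : (⊤ : Submodule R (Abelian.Ext N M j)) ≤ maximalIdeal R • ⊤ := by
    intro y _
    obtain ⟨z, hz⟩ := Abelian.Ext.contravariant_sequence_exact₁ hreg.smulShortComplex_shortExact M
      (n₁ := j + 1) y (add_comm 1 j) (h.elim _ _)
    have hz' : x • z = y := by
      rw [← hz, ← ext_mk₀_smul_id_comp]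
      rfl
    rw [← hz']
    exact Submodule.smul_mem_smul hx trivial
  have hbot := Submodule.eq_bot_of_le_smul_of_le_jacobson_bot _ _ (Module.Finite.fg_top) key
    (IsLocalRing.maximalIdeal_le_jacobson ⊥)
  exact (Submodule.subsingleton_iff R).mp (subsingleton_of_bot_eq_top hbot.symm)

/-- Vanishing of `Ext` passes to the middle term of a short exact sequence in the first variable. -/
lemma subsingleton_ext_of_exact_left {R : Type u} [CommRing R] {A B C : Type u}
    [AddCommGroup A] [Module R A] [AddCommGroup B] [Module R B] [AddCommGroup C] [Module R C]
    {f : A →ₗ[R] B} {g : B →ₗ[R] C} (hf : Function.Injective f) (hg : Function.Surjective g)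
    (hfg : Function.Exact f g) (M : ModuleCat.{u} R) (j : ℕ)
    (hA : Subsingleton (Abelian.Ext (ModuleCat.of R A) M j))
    (hC : Subsingleton (Abelian.Ext (ModuleCat.of R C) M j)) :
    Subsingleton (Abelian.Ext (ModuleCat.of R B) M j) := by
  have hS := ModuleCat.shortComplex_shortExact
    (ModuleCat.shortComplexOfCompEqZero f g hfg.linearMap_comp_eq_zero) hfg hf hg
  refine subsingleton_of_forall_eq 0 fun y => ?_
  obtain ⟨z, rfl⟩ := Abelian.Ext.contravariant_sequence_exact₂ hS M y (hA.elim _ _)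
  rw [show z = 0 from hC.elim _ _, Abelian.Ext.comp_zero]

/-- In a short exact sequence in the second variable, `Ext` of the last term vanishes if `Ext` of
the middle term and the next `Ext` of the first term do. -/
lemma subsingleton_ext_of_exact_right {R : Type u} [CommRing R] {A B C : Type u}
    [AddCommGroup A] [Module R A] [AddCommGroup B] [Module R B] [AddCommGroup C] [Module R C]
    {f : A →ₗ[R] B} {g : B →ₗ[R] C} (hf : Function.Injective f) (hg : Function.Surjective g)
    (hfg : Function.Exact f g) (N : ModuleCat.{u} R) (j : ℕ)
    (hA : Subsingleton (Abelian.Ext N (ModuleCat.of R A) (j + 1)))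
    (hB : Subsingleton (Abelian.Ext N (ModuleCat.of R B) j)) :
    Subsingleton (Abelian.Ext N (ModuleCat.of R C) j) := by
  have hS := ModuleCat.shortComplex_shortExact
    (ModuleCat.shortComplexOfCompEqZero f g hfg.linearMap_comp_eq_zero) hfg hf hg
  refine subsingleton_of_forall_eq 0 fun y => ?_
  obtain ⟨z, rfl⟩ := Abelian.Ext.covariant_sequence_exact₃ N hS y rfl (hA.elim _ _)
  rw [show z = 0 from hB.elim _ _, Abelian.Ext.zero_comp]

lemma subsingleton_ext_zero_iff {R : Type u} [CommRing R] (N M : ModuleCat.{u} R) :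
    Subsingleton (Abelian.Ext N M 0) ↔ Subsingleton (N →ₗ[R] M) :=
  (Abelian.Ext.addEquiv₀.trans ModuleCat.homAddEquiv).toEquiv.subsingleton_congr

lemma subsingleton_ext_of_subsingleton_left {R : Type u} [CommRing R] (N M : ModuleCat.{u} R)
    [Subsingleton N] (j : ℕ) : Subsingleton (Abelian.Ext N M j) :=
  subsingleton_of_forall_eq 0 fun y => by
    rw [← Abelian.Ext.mk₀_id_comp y, (ModuleCat.isZero_of_subsingleton N).eq_of_src (𝟙 N) 0,
      Abelian.Ext.mk₀_zero, Abelian.Ext.zero_comp]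

lemma subsingleton_ext_of_subsingleton_right {R : Type u} [CommRing R] (N M : ModuleCat.{u} R)
    [Subsingleton M] (j : ℕ) : Subsingleton (Abelian.Ext N M j) :=
  subsingleton_of_forall_eq 0 fun y => by
    rw [← Abelian.Ext.comp_mk₀_id y, (ModuleCat.isZero_of_subsingleton M).eq_of_src (𝟙 M) 0,
      Abelian.Ext.mk₀_zero, Abelian.Ext.comp_zero]

/-- **Ischebeck's theorem**: `Ext N M j` vanishes for `j + dim N < depth M`. -/
theorem subsingleton_ext_of_isRegular {R : Type u} [CommRing R] [IsLocalRing R]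
    [IsNoetherianRing R] (M : ModuleCat.{u} R) [Module.Finite R M] (rs : List R)
    (hrs : ∀ r ∈ rs, r ∈ maximalIdeal R) (hreg : RingTheory.Sequence.IsRegular M rs) (s : ℕ) :
    ∀ (N : Type u) [AddCommGroup N] [Module R N] [Module.Finite R N],
      (∀ q ∈ Module.support R N, Order.coheight q ≤ s) → ∀ j : ℕ, j + s < rs.length →
      Subsingleton (Abelian.Ext (ModuleCat.of R N) M j) := by
  have hM : Nontrivial M := hreg.nontrivial
  induction s using Nat.strong_induction_on with
  | _ s ih =>
    intro N _ _ hfin hN j hj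
    induction hfin using IsNoetherianRing.induction_on_isQuotientEquivQuotientPrime R with
    | subsingleton N => exact subsingleton_ext_of_subsingleton_left _ _ _
    | exact N₁ N₂ N₃ f g hf hg hfg h₁ h₃ =>
      exact subsingleton_ext_of_exact_left hf hg hfg M j
        (h₁ fun q hq => hN q (Module.support_subset_of_injective f hf hq))
        (h₃ fun q hq => hN q (Module.support_subset_of_surjective g hg hq))
    | quotient N p e =>
      have hsupp : Module.support R N = PrimeSpectrum.zeroLocus p.1 := by
        rw [e.support_eq, Module.support_eq_zeroLocus, Ideal.annihilator_quotient]
      have hp := hN p (by simp [hsupp])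
      by_cases hpm : p.1 = maximalIdeal R
      · refine ModuleCat.subsingleton_ext_of_exists_isRegular (maximalIdeal R) (ModuleCat.of R N)
          (by rw [← hpm]; exact hsupp.le) M ?_ rs hrs hreg j (by omega)
        exact lt_top_iff_ne_top.mpr fun h =>
          (Submodule.top_ne_ideal_smul_of_le_jacobson_annihilator
            (IsLocalRing.maximalIdeal_le_jacobson _)) h.symm
      · have hlt : p.1 < maximalIdeal R :=
          lt_of_le_of_ne (IsLocalRing.le_maximalIdeal p.2.ne_top) hpm
        obtain ⟨x, hx, hxp⟩ := SetLike.exists_of_lt hlt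
        have hs : 1 ≤ s := by
          have hp1 := Order.coheight_add_one_le (a := IsLocalRing.closedPoint R) (b := p) hlt
          exact_mod_cast (le_add_self.trans hp1).trans hp
        have hxN : IsSMulRegular N x := by
          rw [e.isSMulRegular_congr]
          refine isSMulRegular_iff_right_eq_zero_of_smul.mpr fun y hy => ?_
          obtain ⟨y, rfl⟩ := Ideal.Quotient.mk_surjective y
          rw [Algebra.smul_def, Ideal.Quotient.algebraMap_eq, ← map_mul,
            Ideal.Quotient.eq_zero_iff_mem] at hy
          exact Ideal.Quotient.eq_zero_iff_mem.mpr ((p.2.mem_or_mem hy).resolve_left hxp)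
        refine subsingleton_ext_of_quotSMulTop (ModuleCat.of R N) M hx hxN j
          (ih (s - 1) (by omega) (QuotSMulTop x N) (fun q hq => ?_) (j + 1) (by omega))
        rw [Module.support_quotSMulTop, hsupp] at hq
        have hpq : p < q := lt_of_le_of_ne hq.1 fun h => hxp (h ▸ hq.2 rfl)
        have hq' := (Order.coheight_add_one_le hpq).trans hp
        obtain ⟨t, rfl⟩ := Nat.exists_eq_add_of_le' hs
        simpa using hq'

/-- **Ischebeck's theorem** in terms of `rdepth`, for quotients by a prime. -/
lemma subsingleton_ext_quotient_of_lt_rdepth {R : Type u} [CommRing R] [IsLocalRing R]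
    [IsNoetherianRing R] (M : Type u) [AddCommGroup M] [Module R M] [Module.Finite R M]
    (p : PrimeSpectrum R) (s j : ℕ) (hp : Order.coheight p ≤ s)
    (hj : ((j + s : ℕ) : ℕ∞) < rdepth R M) :
    Subsingleton (Abelian.Ext (ModuleCat.of R (R ⧸ p.asIdeal)) (ModuleCat.of R M) j) := by
  unfold rdepth at hj
  split_ifs at hj with hM
  · exact subsingleton_ext_of_subsingleton_right _ _ _
  · obtain ⟨_, ⟨rs, hrs, hreg, rfl⟩, hlt⟩ := lt_sSup_iff.mp hj
    refine subsingleton_ext_of_isRegular (ModuleCat.of R M) rs hrs hreg s (R ⧸ p.asIdeal)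
      (fun q hq => ?_) j (by exact_mod_cast hlt)
    rw [Module.support_eq_zeroLocus, Ideal.annihilator_quotient] at hq
    exact (Order.coheight_anti (show p ≤ q from hq)).trans hp

/-- The local acyclicity lemma, for boundaries `B i ≤ ker (f i)` indexed uniformly. -/
theorem boundaries_eq_ker {R : Type u} [CommRing R] [IsLocalRing R] [IsNoetherianRing R]
    (d : ℕ) (hd : ringKrullDim R = d)
    (X : ℕ → Type u) [∀ i, AddCommGroup (X i)] [∀ i, Module R (X i)] [∀ i, Module.Finite R (X i)]
    (f : ∀ i, X i →ₗ[R] X (i + 1)) (B : ∀ i, Submodule R (X i))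
    (hB0 : B 0 = ⊥) (hB : ∀ i, B (i + 1) = LinearMap.range (f i))
    (hle : ∀ i, B i ≤ LinearMap.ker (f i))
    (hdepth : ∀ i, ((d - i : ℕ) : ℕ∞) ≤ rdepth R (X i))
    (hvan : ∀ i, d ≤ i → B i = LinearMap.ker (f i))
    (hloc : ∀ i, ∀ p ∈ Module.support R (LinearMap.ker (f i) ⧸ (B i).submoduleOf
      (LinearMap.ker (f i))), ¬ Order.height p ≤ (i : ℕ)) (i : ℕ) :
    B i = LinearMap.ker (f i) := by
  induction i using Nat.strong_induction_on with
  | _ i ih =>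
    rcases le_or_gt d i with hdi | hdi
    · exact hvan i hdi
    rw [← (hle i).ge_iff_eq, ← Submodule.submoduleOf_eq_top,
      ← Submodule.Quotient.subsingleton_iff]
    by_contra hH
    rw [not_subsingleton_iff_nontrivial] at hH
    obtain ⟨p, hp⟩ := associatedPrimes.nonempty R
      (LinearMap.ker (f i) ⧸ (B i).submoduleOf (LinearMap.ker (f i)))
    obtain ⟨hpp, g, hg⟩ := (isAssociatedPrime_iff_exists_injective_linearMap ..).mp hp
    let P : PrimeSpectrum R := ⟨p, hpp⟩
    have hht := hloc i P (Module.support_subset_of_injective g hg (by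
      rw [Module.support_eq_zeroLocus, Ideal.annihilator_quotient]; exact le_refl p))
    have hco : Order.coheight P ≤ (d - (i + 1) : ℕ) := by
      have hle' : Order.height P + Order.coheight P ≤ d := by
        have h := Order.krullDim_eq_iSup_height_add_coheight_of_nonempty (α := PrimeSpectrum R)
        rw [show Order.krullDim (PrimeSpectrum R) = (d : WithBot ℕ∞) from hd] at h
        have h' : ((d : ℕ∞) : WithBot ℕ∞) = _ := h
        rw [WithBot.coe_inj.mp h']
        exact le_iSup (fun a : PrimeSpectrum R => Order.height a + Order.coheight a) P
      generalize Order.height P = a at *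
      generalize Order.coheight P = b at *
      lift a to ℕ using (by rintro rfl; simp at hle')
      lift b to ℕ using (by rintro rfl; simp at hle')
      norm_cast at *
      omega
    have hX (j l : ℕ) (hjl : l + j < i + 1) :
        Subsingleton (Abelian.Ext (ModuleCat.of R (R ⧸ p)) (ModuleCat.of R (X j)) l) :=
      subsingleton_ext_quotient_of_lt_rdepth (X j) P _ l hco
        (lt_of_lt_of_le (by norm_cast; omega) (hdepth j))
    have hBext (j : ℕ) : j ≤ i → ∀ l, l + j ≤ i + 1 →
        Subsingleton (Abelian.Ext (ModuleCat.of R (R ⧸ p)) (ModuleCat.of R (B j)) l) := by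
      induction j with
      | zero =>
        intro _ l _
        rw [hB0]
        exact subsingleton_ext_of_subsingleton_right _ _ _
      | succ j ihj =>
        intro hj l hl
        rw [hB]
        refine subsingleton_ext_of_exact_right (B j).injective_subtype
          (f j).surjective_rangeRestrict ?_ _ l (ihj (by omega) (l + 1) (by omega))
          (hX j l (by omega))
        rw [LinearMap.exact_iff, LinearMap.ker_rangeRestrict, Submodule.range_subtype, ih j hj]
    have hZ : Subsingleton (Abelian.Ext (ModuleCat.of R (R ⧸ p))
        (ModuleCat.of R (LinearMap.ker (f i))) 0) := by
      rw [subsingleton_ext_zero_iff]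
      have := (subsingleton_ext_zero_iff _ _).mp (hX i 0 (by omega))
      exact ⟨fun a b => LinearMap.ext fun x => Subtype.ext <| LinearMap.congr_fun
        (this.elim ((LinearMap.ker (f i)).subtype ∘ₗ a) ((LinearMap.ker (f i)).subtype ∘ₗ b)) x⟩
    have hHext := subsingleton_ext_of_exact_right (Submodule.inclusion_injective (hle i))
      (Submodule.mkQ_surjective ((B i).submoduleOf (LinearMap.ker (f i))))
      (by rw [LinearMap.exact_iff, Submodule.ker_mkQ, Submodule.range_inclusion]; rfl)
      (ModuleCat.of R (R ⧸ p)) 0 (hBext i le_rfl 1 (by omega)) hZ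
    have hg0 : g = 0 := ((subsingleton_ext_zero_iff _ _).mp hHext).elim _ _
    have h1 : (1 : R ⧸ p) = 0 := hg (by simp [hg0])
    have := Ideal.Quotient.nontrivial_iff.mpr hpp.ne_top
    exact one_ne_zero h1

/-- the local variant of the Acyclicity Lemma. -/
theorem stmt5 (R : Type u) [CommRing R] [IsLocalRing R] [IsNoetherianRing R]
    (hCM : IsCMLocalRing R) (d : ℕ) (hd : ringKrullDim R = d)
    (w : Type u) [AddCommGroup w] [Module R w] (hw : IsCanonicalModule R w)
    (X : ℕ → Type u) [∀ i, AddCommGroup (X i)] [∀ i, Module R (X i)]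
    [∀ i, Module.Finite R (X i)]
    (f : ∀ i, X i →ₗ[R] X (i + 1))
    (hc : ∀ i, (f (i + 1)) ∘ₗ (f i) = 0)
    (hdepth : ∀ i, ((d - i : ℕ) : ℕ∞) ≤ rdepth R (X i))
    (hvan0 : d = 0 → LinearMap.ker (f 0) = ⊥)
    (hvan : ∀ i, d ≤ i + 1 → LinearMap.range (f i) = LinearMap.ker (f (i + 1)))
    (hloc0 : ∀ (p : Ideal R) (hp : p.IsPrime), primeHeight p hp ≤ 0 →
      Subsingleton (LocalizedModule p.primeCompl (LinearMap.ker (f 0))))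
    (hloc : ∀ (i : ℕ) (p : Ideal R) (hp : p.IsPrime), primeHeight p hp ≤ (i + 1 : ℕ) →
      Subsingleton (LocalizedModule p.primeCompl
        ((LinearMap.ker (f (i + 1))) ⧸
          ((LinearMap.range (f i)).comap (LinearMap.ker (f (i + 1))).subtype)))) :
    LinearMap.ker (f 0) = ⊥ ∧
      ∀ i, LinearMap.range (f i) = LinearMap.ker (f (i + 1)) := by
  let B : ∀ i, Submodule R (X i) := fun i => match i with
    | 0 => ⊥
    | i + 1 => LinearMap.range (f i)
  have key := boundaries_eq_ker d hd X f B rfl (fun _ => rfl)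
    (fun i => match i with
      | 0 => bot_le
      | i + 1 => LinearMap.range_le_ker_iff.mpr (hc i)) hdepth
    (fun i => match i with
      | 0 => fun h => (hvan0 (by omega)).symm
      | i + 1 => hvan i)
    (fun i => match i with
      | 0 => fun p hp h => not_subsingleton_iff_nontrivial.mpr (Module.mem_support_iff.mp
          (Module.support_subset_of_surjective _ (Submodule.mkQ_surjective _) hp))
          (hloc0 p.1 p.2 h)
      | i + 1 => fun p hp h => not_subsingleton_iff_nontrivial.mpr (Module.mem_support_iff.mp hp)
          (hloc i p.1 p.2 h))
  exact ⟨(key 0).symm, fun i => key (i + 1)⟩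
end

section
/- (Auslander–Buchsbaum for non-singular orders) Let (R, m) be a local Cohen-Macaulay ring with a canonical module ω_R, and let Λ be a non-singular R-order, i.e., Λ is a module-finite R-algebra that is a maximal Cohen-Macaulay R-module and gl.dim Λ_p = dim R_p for all primes p of R. Then for any finitely generated Λ-module X, depth_R X + proj.dim_Λ X = dim R. -/
open CategoryTheory IsLocalRing
open scoped Classical

universe u

lemma extVanish_iff_exists_factor {A : Type u} [Ring A] {X : ModuleCat.{u} A}
    (P : ProjectiveResolution X) (i : ℕ) (Y : ModuleCat.{u} A) :
    extVanish A (i + 1) X Y ↔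
      ∀ f : P.complex.X (i + 1) ⟶ Y, P.complex.d (i + 2) (i + 1) ≫ f = 0 →
        ∃ g : P.complex.X i ⟶ Y, P.complex.d (i + 1) i ≫ g = f := by
  unfold extVanish
  rw [← ModuleCat.isZero_iff_subsingleton, (P.isoExt (R := ℤ) (i + 1) Y).isZero_iff,
    ← HomologicalComplex.exactAt_iff_isZero_homology,
    HomologicalComplex.exactAt_iff' _ i (i + 1) (i + 2) (by simp) (by simp),
    ShortComplex.moduleCat_exact_iff]
  rfl

lemma extVanish_succ_iff_subsingleton_ext {A : Type u} [Ring A] (X Y : ModuleCat.{u} A) (i : ℕ) :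
    extVanish A (i + 1) X Y ↔ Subsingleton (Abelian.Ext.{u} X Y (i + 1)) := by
  let P := projectiveResolution X
  rw [extVanish_iff_exists_factor P]
  refine ⟨fun h ↦ subsingleton_of_forall_eq 0 fun e ↦ ?_, fun h f hf ↦ ?_⟩
  · obtain ⟨f, hf, rfl⟩ := P.extMk_surjective e (i + 2) rfl
    exact (P.extMk_eq_zero_iff f (i + 2) rfl hf i rfl).2 (h f hf)
  · exact (P.extMk_eq_zero_iff f (i + 2) rfl hf i rfl).1 (Subsingleton.elim _ _)

lemma hasProjectiveDimensionLE_iff_extVanish {A : Type u} [Ring A] (X : ModuleCat.{u} A) (n : ℕ) :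
    HasProjectiveDimensionLE X n ↔
      ∀ i : ℕ, (n : ℕ∞) < (i : ℕ∞) → ∀ Y : ModuleCat.{u} A, extVanish A i X Y := by
  refine ⟨fun h i hi Y ↦ ?_, fun h ↦ HasProjectiveDimensionLT.mk fun i hi Y e ↦ ?_⟩
  · obtain ⟨i, rfl⟩ := Nat.exists_eq_succ_of_ne_zero (Nat.ne_zero_of_lt (Nat.cast_lt.1 hi))
    exact (extVanish_succ_iff_subsingleton_ext X Y i).2
      (HasProjectiveDimensionLT.subsingleton X (n + 1) _ (Nat.cast_lt.1 hi) Y)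
  · obtain ⟨i, rfl⟩ := Nat.exists_eq_succ_of_ne_zero (Nat.ne_zero_of_lt hi)
    have := (extVanish_succ_iff_subsingleton_ext X Y i).1 (h _ (Nat.cast_lt.2 hi) Y)
    exact Subsingleton.elim _ _

section LinearAbelian

variable {R : Type*} [CommRing R] {C : Type*} [Category C] [Abelian C] [Linear R C]
  [HasExt.{u} C] {S : ShortComplex C}

lemma CategoryTheory.ShortComplex.ShortExact.exists_comp_add_smul_eq_id (hS : S.ShortExact)
    [Projective S.X₂] (x : R) (h : ∀ e : Abelian.Ext.{u} S.X₃ S.X₁ 1, ∃ e', x • e' = e) :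
    ∃ (f : S.X₁ ⟶ S.X₁) (g : S.X₂ ⟶ S.X₁), S.f ≫ g + x • f = 𝟙 S.X₁ := by
  obtain ⟨e, he⟩ := h hS.extClass
  obtain ⟨f, rfl⟩ := Abelian.Ext.contravariant_sequence_exact₃ hS _ e
    (Abelian.Ext.eq_zero_of_projective _) (add_zero 1)
  obtain ⟨f, rfl⟩ := (Abelian.Ext.mk₀_bijective _ _).2 f
  obtain ⟨g, hg⟩ := Abelian.Ext.contravariant_sequence_exact₁ hS _
    (Abelian.Ext.mk₀ (𝟙 S.X₁ - x • f)) (add_zero 1) (by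
      simp [sub_eq_add_neg, Abelian.Ext.mk₀_add, Abelian.Ext.mk₀_neg, Abelian.Ext.mk₀_smul, he])
  obtain ⟨g, rfl⟩ := (Abelian.Ext.mk₀_bijective _ _).2 g
  refine ⟨f, g, ?_⟩
  rw [Abelian.Ext.mk₀_comp_mk₀] at hg
  rw [(Abelian.Ext.mk₀_bijective _ _).1 hg, sub_add_cancel]

lemma CategoryTheory.ShortComplex.ShortExact.exists_smul_eq_of_projective (hS : S.ShortExact)
    [Projective S.X₂] (x : R) (n : ℕ) (Y : C)
    (h : ∀ e : Abelian.Ext.{u} S.X₃ Y (n + 2), ∃ e', x • e' = e)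
    (e : Abelian.Ext.{u} S.X₁ Y (n + 1)) : ∃ e', x • e' = e := by
  obtain ⟨e₀, he₀⟩ := h (hS.extClass.comp e (by lia))
  obtain ⟨e₁, rfl⟩ := Abelian.Ext.contravariant_sequence_exact₃ hS _ e₀
    (Abelian.Ext.eq_zero_of_projective _) (by lia : 1 + (n + 1) = n + 2)
  obtain ⟨e₂, he₂⟩ := Abelian.Ext.contravariant_sequence_exact₁ hS _ (e - x • e₁)
    (by lia : 1 + (n + 1) = n + 2) (by simp [sub_eq_add_neg, ← he₀])
  refine ⟨e₁, ?_⟩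
  rw [Abelian.Ext.eq_zero_of_projective e₂, Abelian.Ext.comp_zero] at he₂
  exact (sub_eq_zero.1 he₂.symm).symm

/-- If `Ext^(n + 1)` out of the cokernel of multiplication by `x` vanishes, then multiplication by
`x` is surjective on `Ext^n`. -/
lemma CategoryTheory.ShortComplex.ShortExact.exists_smul_eq_of_hasProjectiveDimensionLT
    (hS : S.ShortExact) (x : R) (φ : S.X₂ ≅ S.X₁) (hφ : φ.hom ≫ S.f = x • 𝟙 S.X₂) (n : ℕ)
    [HasProjectiveDimensionLT S.X₃ (n + 1)] (Y : C) (e : Abelian.Ext.{u} S.X₂ Y n) :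
    ∃ e', x • e' = e := by
  obtain ⟨e', he'⟩ := Abelian.Ext.contravariant_sequence_exact₁ hS _
    ((Abelian.Ext.mk₀ φ.inv).comp e (zero_add n)) (add_comm 1 n)
    (Abelian.Ext.eq_zero_of_hasProjectiveDimensionLT _ (n + 1) le_rfl)
  refine ⟨e', ?_⟩
  have := congr((Abelian.Ext.mk₀ φ.hom).comp $he' (zero_add n))
  simpa [hφ, Abelian.Ext.mk₀_smul] using this

end LinearAbelian

lemma LinearMap.bijective_of_add_smul_eq_id {R M : Type*} [CommRing R] [IsLocalRing R]
    [IsNoetherianRing R] [AddCommGroup M] [Module R M] [Module.Finite R M] {x : R}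
    (hx : x ∈ maximalIdeal R) {ψ f : M →ₗ[R] M} (h : ∀ m, ψ m + x • f m = m) :
    Function.Bijective ψ := by
  have hs : Function.Surjective ψ := by
    rw [← LinearMap.range_eq_top, ← top_le_iff]
    refine Submodule.le_of_le_smul_of_le_jacobson_bot (I := maximalIdeal R)
      Module.Finite.fg_top (maximalIdeal_le_jacobson _) fun m _ ↦ ?_
    rw [← h m]
    exact Submodule.add_mem_sup ⟨m, rfl⟩ (Submodule.smul_mem_smul hx trivial)
  exact ⟨IsNoetherian.injective_of_surjective_endomorphism ψ hs, hs⟩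

open scoped ModuleCat.Algebra in
lemma exists_smul_eq_of_hasProjectiveDimensionLE_quotient
    {R : Type u} [CommRing R] {A : Type u} [Ring A] [Algebra R A] {X : Type u} [AddCommGroup X]
    [Module R X] [Module A X] [IsScalarTower R A X] {x : R} (hreg : IsSMulRegular X x) (n : ℕ)
    (h : HasProjectiveDimensionLE (ModuleCat.of A (X ⧸ (LinearMap.range
      (algebraMap R (Module.End A X) x)))) n) (Y : ModuleCat.{u} A)
    (e : Abelian.Ext.{u} (ModuleCat.of A X) Y n) : ∃ e', x • e' = e := by
  let f : X →ₗ[A] X := algebraMap R (Module.End A X) x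
  let S : ShortComplex (ModuleCat.{u} A) := .mk (ModuleCat.ofHom f)
    (ModuleCat.ofHom (LinearMap.range f).mkQ) (by ext; simp)
  have hS : S.ShortExact := {
    exact := (ShortComplex.ShortExact.moduleCat_exact_iff_function_exact S).2 fun y ↦ by
      simp [S]
    mono_f := (ModuleCat.mono_iff_injective _).2 hreg
    epi_g := (ModuleCat.epi_iff_surjective _).2 (Submodule.mkQ_surjective _) }
  have : HasProjectiveDimensionLT S.X₃ (n + 1) := h
  refine hS.exists_smul_eq_of_hasProjectiveDimensionLT x (Iso.refl (ModuleCat.of A X)) ?_ n Y e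
  ext m
  exact (algebraMap_smul A x m).symm

lemma exists_shortExact_projective_finite {A : Type u} [Ring A] [IsNoetherianRing A]
    (X : ModuleCat.{u} A) [Module.Finite A X] : ∃ S : ShortComplex (ModuleCat.{u} A),
      S.ShortExact ∧ Projective S.X₂ ∧ Module.Finite A S.X₁ ∧ S.X₃ = X := by
  obtain ⟨m, p, hp⟩ := Module.Finite.exists_fin' A X
  exact ⟨p.shortComplexKer, LinearMap.shortExact_shortComplexKer hp,
    (IsProjective.iff_projective _).1 (inferInstanceAs (Module.Projective A (Fin m → A))),
    inferInstanceAs (Module.Finite A (LinearMap.ker p)), rfl⟩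

section ModuleFiniteAlgebra

variable {R : Type u} [CommRing R] [IsLocalRing R] [IsNoetherianRing R]
  {A : Type u} [Ring A] [Algebra R A] [Module.Finite R A]

open scoped ModuleCat.Algebra in
lemma CategoryTheory.ShortComplex.ShortExact.projective_of_forall_exists_smul_eq
    {S : ShortComplex (ModuleCat.{u} A)} (hS : S.ShortExact) [Projective S.X₂]
    [Module.Finite A S.X₁] {x : R} (hx : x ∈ maximalIdeal R)
    (h : ∀ e : Abelian.Ext.{u} S.X₃ S.X₁ 1, ∃ e', x • e' = e) : Projective S.X₃ := by
  have : Module.Finite R S.X₁ := Module.Finite.trans A _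
  obtain ⟨f, g, hfg⟩ := hS.exists_comp_add_smul_eq_id x h
  have hb := LinearMap.bijective_of_add_smul_eq_id (M := S.X₁) hx
    (ψ := (S.f ≫ g).hom.restrictScalars R) (f := f.hom.restrictScalars R) fun m ↦
      congr($(hfg).hom m)
  have : IsIso (S.f ≫ g) := (ConcreteCategory.isIso_iff_bijective _).2 hb
  let s := ShortComplex.Splitting.ofExactOfRetraction S hS.exact (g ≫ inv (S.f ≫ g))
    (by simp [← Category.assoc]) hS.epi_g
  have r : Retract S.X₃ S.X₂ := ⟨s.s, S.g, s.s_g⟩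
  exact r.projective

open scoped ModuleCat.Algebra in
lemma hasProjectiveDimensionLE_of_forall_exists_smul_eq {x : R} (hx : x ∈ maximalIdeal R) (n : ℕ)
    (X : ModuleCat.{u} A) [Module.Finite A X]
    (h : ∀ (Y : ModuleCat.{u} A) (e : Abelian.Ext.{u} X Y (n + 1)), ∃ e', x • e' = e) :
    HasProjectiveDimensionLE X n := by
  have : IsNoetherianRing A := isNoetherian_of_tower R inferInstance
  induction n generalizing X with
  | zero =>
    obtain ⟨S, hS, _, _, rfl⟩ := exists_shortExact_projective_finite X
    have := hS.projective_of_forall_exists_smul_eq hx (h _)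
    rwa [projective_iff_hasProjectiveDimensionLT_one] at this
  | succ n ih =>
    obtain ⟨S, hS, _, _, rfl⟩ := exists_shortExact_projective_finite X
    exact (hS.hasProjectiveDimensionLT_X₃_iff n inferInstance).2
      (ih S.X₁ fun Y e ↦ hS.exists_smul_eq_of_projective x n Y (h Y) e)

open scoped ModuleCat.Algebra in
lemma hasProjectiveDimensionLE_of_quotient {X : Type u} [AddCommGroup X]
    [Module R X] [Module A X] [IsScalarTower R A X] [Module.Finite A X] [Nontrivial X] {x : R}
    (hx : x ∈ maximalIdeal R) (hreg : IsSMulRegular X x) (n : ℕ)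
    (h : HasProjectiveDimensionLE (ModuleCat.of A (X ⧸ (LinearMap.range
      (algebraMap R (Module.End A X) x)))) n) :
    1 ≤ n ∧ HasProjectiveDimensionLE (ModuleCat.of A X) (n - 1) := by
  have H := exists_smul_eq_of_hasProjectiveDimensionLE_quotient hreg n h
  cases n with
  | zero =>
    obtain ⟨e, he⟩ := H (ModuleCat.of A X) (Abelian.Ext.mk₀ (𝟙 _))
    obtain ⟨f, rfl⟩ := (Abelian.Ext.mk₀_bijective _ _).2 e
    rw [← Abelian.Ext.mk₀_smul] at he
    have hf : ∀ m : X, x • f.hom m = m := fun m ↦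
      (algebraMap_smul A x (f.hom m : X)).symm.trans
        congr($((Abelian.Ext.mk₀_bijective _ _).1 he).hom m)
    have : Module.Finite R X := Module.Finite.trans A X
    refine absurd ?_ (Submodule.top_ne_pointwise_smul_of_mem_jacobson_annihilator (M := X)
      (maximalIdeal_le_jacobson _ hx))
    exact (eq_top_iff.2 fun m _ ↦ ⟨f.hom m, trivial, hf m⟩).symm
  | succ n => exact ⟨by lia, hasProjectiveDimensionLE_of_forall_exists_smul_eq hx n _ H⟩

lemma length_le_and_hasProjectiveDimensionLE {d : ℕ}
    (hd : ∀ M : ModuleCat.{u} A, HasProjectiveDimensionLE M d) {X : Type u} [AddCommGroup X]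
    [Module R X] [Module A X] [IsScalarTower R A X] [Module.Finite A X] {rs : List R}
    (hrs : ∀ r ∈ rs, r ∈ maximalIdeal R) (hreg : RingTheory.Sequence.IsRegular X rs) :
    rs.length ≤ d ∧ HasProjectiveDimensionLE (ModuleCat.of A X) (d - rs.length) := by
  induction rs generalizing X with
  | nil => exact ⟨zero_le, hd _⟩
  | cons x rs ih =>
    have := hreg.nontrivial
    rw [RingTheory.Sequence.isRegular_cons_iff] at hreg
    let f : X →ₗ[A] X := algebraMap R (Module.End A X) x
    have e : QuotSMulTop x X ≃ₗ[R] (X ⧸ LinearMap.range f) :=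
      Submodule.quotEquivOfEq _ ((LinearMap.range f).restrictScalars R) (by
        ext m
        simp [Submodule.mem_smul_pointwise_iff_exists, f]) ≪≫ₗ
      Submodule.Quotient.restrictScalarsEquiv R _
    have h := ih (X := X ⧸ LinearMap.range f) (fun r hr ↦ hrs r (by simp [hr]))
      ((e.isRegular_congr rs).1 hreg.2)
    have h' := hasProjectiveDimensionLE_of_quotient (hrs x (by simp)) hreg.1 _ h.2
    rw [Nat.sub_sub] at h'
    exact ⟨by have := h'.1; simp; lia, h'.2⟩

end ModuleFiniteAlgebra

lemma subsingleton_ext_pi {R : Type u} [CommRing R] (N : ModuleCat.{u} R) {L : Type u}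
    [AddCommGroup L] [Module R L] (i : ℕ)
    (h : Subsingleton (Abelian.Ext.{u} N (ModuleCat.of R L) i)) (m : ℕ) :
    Subsingleton (Abelian.Ext.{u} N (ModuleCat.of R (Fin m → L)) i) := by
  refine subsingleton_of_forall_eq 0 fun e ↦ ?_
  have hid : ∑ j : Fin m, ModuleCat.ofHom (LinearMap.proj (R := R) (φ := fun _ ↦ L) j) ≫
      ModuleCat.ofHom (LinearMap.single R (fun _ ↦ L) j) = 𝟙 (ModuleCat.of R (Fin m → L)) := by
    ext v k
    simp [ModuleCat.hom_sum, Pi.single_apply]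
  rw [← Abelian.Ext.comp_mk₀_id e, ← hid, Abelian.Ext.mk₀_sum, Abelian.Ext.comp_sum]
  refine Finset.sum_eq_zero fun j _ ↦ ?_
  rw [← Abelian.Ext.mk₀_comp_mk₀,
    ← Abelian.Ext.comp_assoc _ _ _ (add_zero i) (add_zero 0) (by simp),
    Subsingleton.elim (e.comp _ (add_zero i)) 0, Abelian.Ext.zero_comp]

lemma subsingleton_ext_of_hasProjectiveDimensionLE {R : Type u} [CommRing R]
    {A : Type u} [Ring A] [Algebra R A] [IsNoetherianRing A] (N : ModuleCat.{u} R) {d : ℕ}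
    (hA : ∀ i < d, Subsingleton (Abelian.Ext.{u} N (ModuleCat.of R A) i)) (n : ℕ)
    (M : Type u) [AddCommGroup M] [Module A M] [Module R M] [IsScalarTower R A M]
    [Module.Finite A M] (hM : HasProjectiveDimensionLE (ModuleCat.of A M) n) (i : ℕ)
    (hi : i + n < d) : Subsingleton (Abelian.Ext.{u} N (ModuleCat.of R M) i) := by
  induction n generalizing M i with
  | zero =>
    obtain ⟨m, p, hp⟩ := Module.Finite.exists_fin' A M
    have : Module.Projective A M :=
      (IsProjective.iff_projective _).2 ((projective_iff_hasProjectiveDimensionLT_one).2 hM)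
    obtain ⟨s, hs⟩ := Module.projective_lifting_property p LinearMap.id hp
    have := subsingleton_ext_pi N i (hA i (by lia)) m
    refine subsingleton_of_forall_eq 0 fun e ↦ ?_
    have hid : ModuleCat.ofHom (s.restrictScalars R) ≫ ModuleCat.ofHom (p.restrictScalars R) =
        𝟙 (ModuleCat.of R M) := by
      ext v
      exact congr($hs v)
    rw [← Abelian.Ext.comp_mk₀_id e, ← hid, ← Abelian.Ext.mk₀_comp_mk₀,
      ← Abelian.Ext.comp_assoc _ _ _ (add_zero i) (add_zero 0) (by simp),
      Subsingleton.elim (e.comp _ (add_zero i)) 0, Abelian.Ext.zero_comp]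
  | succ n ih =>
    obtain ⟨m, p, hp⟩ := Module.Finite.exists_fin' A M
    have hS : p.shortComplexKer.ShortExact := LinearMap.shortExact_shortComplexKer hp
    have hR : (p.restrictScalars R).shortComplexKer.ShortExact :=
      LinearMap.shortExact_shortComplexKer hp
    have : Projective p.shortComplexKer.X₂ := (IsProjective.iff_projective _).1
      (inferInstanceAs (Module.Projective A (Fin m → A)))
    have hK := ih (LinearMap.ker p) ((hS.hasProjectiveDimensionLT_X₃_iff n inferInstance).1 hM)
      (i + 1) (by lia)
    have := subsingleton_ext_pi N i (hA i (by lia)) m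
    refine subsingleton_of_forall_eq 0 fun e ↦ ?_
    obtain ⟨e', rfl⟩ := Abelian.Ext.covariant_sequence_exact₃ _ hR e rfl
      (hK.elim _ _)
    rw [Subsingleton.elim (α := Abelian.Ext.{u} N (ModuleCat.of R (Fin m → A)) i) e' 0]
    exact Abelian.Ext.zero_comp ..

lemma exists_isRegular_of_hasProjectiveDimensionLE {R : Type u} [CommRing R] [IsLocalRing R]
    [IsNoetherianRing R] {A : Type u} [Ring A] [Algebra R A] [Module.Finite R A]
    {rs : List R} (hrs : ∀ r ∈ rs, r ∈ maximalIdeal R) (hreg : RingTheory.Sequence.IsRegular A rs)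
    (X : Type u) [AddCommGroup X] [Module R X] [Module A X] [IsScalarTower R A X]
    [Module.Finite A X] [Nontrivial X] (n : ℕ)
    (h : HasProjectiveDimensionLE (ModuleCat.of A X) n) :
    ∃ rs' : List R, rs'.length = rs.length - n ∧ (∀ r ∈ rs', r ∈ maximalIdeal R) ∧
      RingTheory.Sequence.IsRegular X rs' := by
  have : IsNoetherianRing A := isNoetherian_of_tower R inferInstance
  have : Module.Finite R X := Module.Finite.trans A X
  have : Nontrivial A := hreg.nontrivial
  have smul_lt (M : Type u) [AddCommGroup M] [Module R M] [Module.Finite R M] [Nontrivial M] :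
      maximalIdeal R • (⊤ : Submodule R M) < ⊤ :=
    (Submodule.top_ne_ideal_smul_of_le_jacobson_annihilator
      (maximalIdeal_le_jacobson _)).symm.lt_top
  have hrs' : ∃ rs' : List R, rs'.length = rs.length ∧ (∀ r ∈ rs', r ∈ maximalIdeal R) ∧
      RingTheory.Sequence.IsRegular (ModuleCat.of R A) rs' := ⟨rs, rfl, hrs, hreg⟩
  have hA := ((ModuleCat.exists_isRegular_tfae (maximalIdeal R) rs.length (ModuleCat.of R A)
    (smul_lt A)).out 3 1).1 hrs'
  exact ((ModuleCat.exists_isRegular_tfae (maximalIdeal R) (rs.length - n) (ModuleCat.of R X)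
    (smul_lt X)).out 1 3).1 fun i hi ↦
      subsingleton_ext_of_hasProjectiveDimensionLE _ hA n X h i (by lia)

lemma projDim_le_coe_iff {A : Type u} [Ring A] {X : Type u} [AddCommGroup X] [Module A X] {n : ℕ} :
    projDim A X ≤ n ↔ HasProjectiveDimensionLE (ModuleCat.of A X) n := by
  rw [hasProjectiveDimensionLE_iff_extVanish]
  refine ⟨fun h i hi ↦ ?_, fun h ↦ sInf_le h⟩
  have hne : {n : ℕ∞ | ∀ i : ℕ, n < (i : ℕ∞) → ∀ Y : ModuleCat.{u} A,
      extVanish A i (ModuleCat.of A X) Y}.Nonempty := ⟨⊤, by simp⟩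
  exact csInf_mem hne i (h.trans_lt hi)

lemma hasProjectiveDimensionLE_of_globalDim_le {A : Type u} [Ring A] {n : ℕ}
    (h : globalDim A ≤ n) (M : ModuleCat.{u} A) : HasProjectiveDimensionLE M n := by
  rw [hasProjectiveDimensionLE_iff_extVanish]
  intro i hi Y
  have hne : {n : ℕ∞ | ∀ i : ℕ, n < (i : ℕ∞) → ∀ X Y : ModuleCat.{u} A,
      extVanish A i X Y}.Nonempty := ⟨⊤, by simp⟩
  exact csInf_mem hne i (h.trans_lt hi) M Y

lemma exists_isRegular_of_rdepth_eq {R : Type u} [CommRing R] [IsLocalRing R]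
    {M : Type u} [AddCommGroup M] [Module R M] {d : ℕ} (h : rdepth R M = d) :
    ∃ rs : List R, rs.length = d ∧ (∀ r ∈ rs, r ∈ maximalIdeal R) ∧
      RingTheory.Sequence.IsRegular M rs := by
  unfold rdepth at h
  split_ifs at h with hM
  · simp at h
  have : Nontrivial M := not_subsingleton_iff_nontrivial.1 hM
  have : Nonempty {n : ℕ∞ | ∃ rs : List R, (∀ r ∈ rs, r ∈ maximalIdeal R) ∧
      RingTheory.Sequence.IsRegular M rs ∧ (rs.length : ℕ∞) = n} := ⟨0, [], by simp, .nil R M, rfl⟩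
  obtain ⟨rs, hrs, hreg, hlen⟩ :=
    ENat.sSup_mem_of_nonempty_of_lt_top (h ▸ ENat.natCast_lt_top d)
  exact ⟨rs, Nat.cast_injective (hlen.trans h), hrs, hreg⟩

theorem rdepth_add_projDim {R : Type u} [CommRing R] [IsLocalRing R]
    [IsNoetherianRing R] {A : Type u} [Ring A] [Algebra R A] [Module.Finite R A] {d : ℕ}
    (hgl : ∀ M : ModuleCat.{u} A, HasProjectiveDimensionLE M d)
    (hd : ∃ rs : List R, rs.length = d ∧ (∀ r ∈ rs, r ∈ maximalIdeal R) ∧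
      RingTheory.Sequence.IsRegular A rs)
    (X : Type u) [AddCommGroup X] [Module R X] [Module A X] [IsScalarTower R A X]
    [Module.Finite A X] [Nontrivial X] : rdepth R X + projDim A X = d := by
  obtain ⟨p, hp⟩ := ENat.ne_top_iff_exists.1
    ((projDim_le_coe_iff.2 (hgl (ModuleCat.of A X))).trans_lt (ENat.natCast_lt_top d)).ne
  have hpd : p ≤ d := by
    rw [← Nat.cast_le (α := ℕ∞), hp]
    exact projDim_le_coe_iff.2 (hgl _)
  obtain ⟨rs₀, rfl, hrs₀, hreg₀⟩ := hd
  obtain ⟨rs, hlen, hrs, hreg⟩ := exists_isRegular_of_hasProjectiveDimensionLE hrs₀ hreg₀ X p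
    (projDim_le_coe_iff.1 hp.ge)
  have hdepth : rdepth R X = (rs₀.length - p : ℕ) := by
    rw [rdepth, if_neg (not_subsingleton_iff_nontrivial.2 ‹_›)]
    refine le_antisymm (sSup_le ?_) (le_sSup ⟨rs, hrs, hreg, by rw [hlen]⟩)
    rintro _ ⟨rs', hrs', hreg', rfl⟩
    obtain ⟨h₁, h₂⟩ := length_le_and_hasProjectiveDimensionLE hgl hrs' hreg'
    have := projDim_le_coe_iff.2 h₂
    rw [← hp, Nat.cast_le] at this
    exact Nat.cast_le.2 (by lia)
  rw [hdepth, ← hp]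
  norm_cast
  lia

lemma hasProjectiveDimensionLE_of_ringEquiv {A B : Type u} [Ring A] [Ring B] (e : B ≃+* A) {n : ℕ}
    (h : ∀ M : ModuleCat.{u} B, HasProjectiveDimensionLE M n) (M : ModuleCat.{u} A) :
    HasProjectiveDimensionLE M n := by
  let := Module.compHom M e.toRingHom
  have : RingHomInvPair (RingHomClass.toRingHom e) (RingHomClass.toRingHom e.symm) :=
    RingHomInvPair.of_ringEquiv e
  have : RingHomInvPair (RingHomClass.toRingHom e.symm) (RingHomClass.toRingHom e) :=
    RingHomInvPair.of_ringEquiv e.symm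
  let e' : ModuleCat.of B M ≃ₛₗ[RingHomClass.toRingHom e] M :=
    { AddEquiv.refl M with map_smul' := fun _ _ ↦ rfl }
  have := h (ModuleCat.of B M)
  exact ModuleCat.hasProjectiveDimensionLE_of_semiLinearEquiv e e' n

lemma LocalizedModule.mkLinearMap_bijective_of_le_isUnit {R : Type u} [CommRing R] {S : Submonoid R}
    (hS : S ≤ IsUnit.submonoid R) (M : Type u) [AddCommGroup M] [Module R M] :
    Function.Bijective (LocalizedModule.mkLinearMap S M) := by
  refine ⟨fun m m' h ↦ ?_, fun y ↦ ?_⟩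
  · obtain ⟨c, hc⟩ := (IsLocalizedModule.eq_iff_exists S (LocalizedModule.mkLinearMap S M)).1 h
    exact (hS c.2).smul_left_cancel.1 hc
  · obtain ⟨⟨m, s⟩, hs⟩ := IsLocalizedModule.surj S (LocalizedModule.mkLinearMap S M) y
    obtain ⟨u, hu⟩ := hS s.2
    refine ⟨(↑u⁻¹ : R) • m, ?_⟩
    rw [map_smul, ← hs, Submonoid.smul_def, ← hu, smul_smul, Units.inv_mul, one_smul]

lemma LocalizedModule.nonempty_ringEquiv_of_le_isUnit {R : Type u} [CommRing R] {S : Submonoid R}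
    (hS : S ≤ IsUnit.submonoid R) (A : Type u) [Ring A] [Algebra R A] :
    Nonempty (LocalizedModule S A ≃+* A) :=
  ⟨(RingEquiv.ofBijective numeratorRingHom (mkLinearMap_bijective_of_le_isUnit hS A)).symm⟩

lemma LocalizedModule.isRegular_of_le_isUnit {R : Type u} [CommRing R] {S : Submonoid R}
    (hS : S ≤ IsUnit.submonoid R) (M : Type u) [AddCommGroup M] [Module R M] {rs : List R}
    (h : RingTheory.Sequence.IsRegular (LocalizedModule S M)
      (rs.map (algebraMap R (Localization S)))) :
    RingTheory.Sequence.IsRegular M rs := by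
  let e := LinearEquiv.ofBijective _ (mkLinearMap_bijective_of_le_isUnit hS M)
  refine (AddEquiv.isRegular_congr (e := e.toAddEquiv) ?_).2 h
  rw [List.forall₂_map_right_iff, List.forall₂_same]
  intro r _ x
  rw [algebraMap_smul]
  exact e.map_smul r x

/-- the Auslander-Buchsbaum formula for non-singular orders. -/
theorem stmt8 (R : Type u) [CommRing R] [IsLocalRing R] [IsNoetherianRing R]
    (hCM : IsCMLocalRing R) (d : ℕ) (hd : ringKrullDim R = d)
    (w : Type u) [AddCommGroup w] [Module R w] (hw : IsCanonicalModule R w)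
    (L : Type u) [Ring L] [Algebra R L] (hL : IsNonsingularOrder R L)
    (X : Type u) [AddCommGroup X] [Module L X] [Module R X] [IsScalarTower R L X]
    [Module.Finite L X] [Nontrivial X] :
    rdepth R X + projDim L X = (d : ℕ∞) := by
  have hS : (maximalIdeal R).primeCompl ≤ IsUnit.submonoid R := fun r hr ↦
    not_not.1 fun h ↦ hr ((mem_maximalIdeal r).2 h)
  let eR := IsLocalization.atUnits R (maximalIdeal R).primeCompl
    (S := Localization.AtPrime (maximalIdeal R)) hS
  have hdim : ringKrullDim (Localization.AtPrime (maximalIdeal R)) = (d : ℕ∞) :=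
    (ringKrullDim_eq_of_ringEquiv eR.toRingEquiv).symm.trans hd
  have := hL.finite
  have hgl (M : ModuleCat.{u} L) : HasProjectiveDimensionLE M d := by
    obtain ⟨e⟩ := LocalizedModule.nonempty_ringEquiv_of_le_isUnit hS L
    have h := WithBot.coe_injective ((hL.gldim (maximalIdeal R) inferInstance).trans hdim)
    exact hasProjectiveDimensionLE_of_ringEquiv e
      (hasProjectiveDimensionLE_of_globalDim_le h.le) M
  have hdepth := WithBot.coe_injective ((hL.mcm (maximalIdeal R) inferInstance).trans hdim)
  obtain ⟨rs, hlen, hrs, hreg⟩ := exists_isRegular_of_rdepth_eq hdepth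
  obtain ⟨rs, rfl⟩ := List.map_surjective_iff.2 eR.surjective rs
  refine rdepth_add_projDim hgl ⟨rs, by simpa using hlen, fun r hr ↦ ?_,
    LocalizedModule.isRegular_of_le_isUnit hS L hreg⟩ X
  exact (IsLocalization.AtPrime.to_map_mem_maximal_iff
    (Localization.AtPrime (maximalIdeal R)) (maximalIdeal R) r).1 (hrs _ (List.mem_map_of_mem hr))
end

section
/- Let R be a 2-dimensional local Cohen-Macaulay normal domain with canonical module, and suppose End_R(M) is a noncommutative crepant resolution of R, i.e., M is a nonzero finitely generated reflexive R-module and End_R(M) is a non-singular R-order. Then every finitely generated reflexive R-module lies in add M; equivalently, add M equals the category of finitely generated reflexive R-modules. -/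
open CategoryTheory IsLocalRing
open scoped Classical

universe u

/-- If `Ext³(X, -)` vanishes then `X` has projective dimension at most two. -/
lemma hasProjectiveDimensionLT_three {A : Type u} [Ring A] (X : ModuleCat.{u} A)
    (h : ∀ Y, extVanish A 3 X Y) : HasProjectiveDimensionLT X 3 := by
  let P := projectiveResolution X
  let K := P.complex
  have hK : ∀ n, K.ExactAt (n + 1) := fun n => P.complex_exactAt_succ n
  obtain ⟨s, hs⟩ : ∃ s : K.X 2 ⟶ K.opcycles 3, K.d 3 2 ≫ s = K.pOpcycles 3 := by
    have h3 := h (K.opcycles 3)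
    unfold extVanish at h3
    have h4 : (K.linearYonedaObj ℤ (K.opcycles 3)).ExactAt 3 := by
      rw [HomologicalComplex.exactAt_iff_isZero_homology]
      exact (ModuleCat.isZero_of_subsingleton _).of_iso (P.isoExt (R := ℤ) 3 (K.opcycles 3)).symm
    rw [HomologicalComplex.exactAt_iff' _ 2 3 4 (by simp) (by simp),
      ShortComplex.moduleCat_exact_iff] at h4
    exact h4 (K.pOpcycles 3) (K.d_pOpcycles 4 3)
  have hr : K.fromOpcycles 3 2 ≫ s = 𝟙 _ := by
    rw [← cancel_epi (K.pOpcycles 3), HomologicalComplex.p_fromOpcycles_assoc, hs, Category.comp_id]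
  let S (n : ℕ) : ShortComplex (ModuleCat.{u} A) :=
    ShortComplex.mk (K.fromOpcycles (n + 1) n) (K.pOpcycles n) (by
      rw [← cancel_epi (K.pOpcycles (n + 1))]; simp)
  have hS : ∀ n, (S n).ShortExact := by
    intro n
    have hm : Mono (K.fromOpcycles (n + 1) n) :=
      Preadditive.mono_of_isZero_kernel' _ (K.homologyIsKernel (n + 1) n (by simp))
        ((HomologicalComplex.exactAt_iff_isZero_homology _ _).1 (hK n))
    have hex : (ShortComplex.mk (K.d (n + 1) n) (K.pOpcycles n) (K.d_pOpcycles _ _)).Exact :=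
      ShortComplex.exact_of_g_is_cokernel _ (K.opcyclesIsCokernel (n + 1) n (by simp))
    let φ : ShortComplex.mk (K.d (n + 1) n) (K.pOpcycles n) (K.d_pOpcycles _ _) ⟶ S n :=
      { τ₁ := K.pOpcycles (n + 1)
        τ₂ := 𝟙 _
        τ₃ := 𝟙 _
        comm₁₂ := by simp [S]
        comm₂₃ := by simp [S] }
    have : Epi φ.τ₁ := inferInstanceAs (Epi (K.pOpcycles (n + 1)))
    have : IsIso φ.τ₂ := inferInstanceAs (IsIso (𝟙 _))
    have : Mono φ.τ₃ := inferInstanceAs (Mono (𝟙 _))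
    exact { exact := (ShortComplex.exact_iff_of_epi_of_isIso_of_mono φ).1 hex
            mono_f := hm
            epi_g := inferInstanceAs (Epi (K.pOpcycles n)) }
  have hproj : ∀ n, Projective (K.X n) := fun n => P.projective n
  have h2 : HasProjectiveDimensionLT (K.opcycles 2) 1 := by
    let σ := ShortComplex.Splitting.ofExactOfRetraction (S 2) (hS 2).exact s hr (hS 2).epi_g
    let ρ : Retract (K.opcycles 2) (K.X 2) := ⟨σ.s, (S 2).g, σ.s_g⟩
    exact (projective_iff_hasProjectiveDimensionLT_one).1 (ρ.projective)
  have h1 : HasProjectiveDimensionLT (K.opcycles 1) 2 :=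
    ((hS 1).hasProjectiveDimensionLT_X₃_iff 0 (hproj 1)).2 h2
  have h0 : HasProjectiveDimensionLT (K.opcycles 0) 3 :=
    ((hS 0).hasProjectiveDimensionLT_X₃_iff 1 (hproj 0)).2 h1
  let ι : K.opcycles 0 ≅ X :=
    (K.opcyclesIsCokernel 1 0 (by simp)).coconePointUniqueUpToIso P.isColimitCokernelCofork
  exact hasProjectiveDimensionLT_of_iso ι 3

/-- Over a ring of global dimension at most two, the kernel of a map between projective modules
is projective. -/
lemma projective_of_globalDim_le_two {A : Type u} [Ring A] (hA : globalDim A ≤ 2)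
    {K P Q : Type u} [AddCommGroup K] [Module A K] [AddCommGroup P] [Module A P]
    [AddCommGroup Q] [Module A Q] [Module.Projective A P] [Module.Projective A Q]
    (i : K →ₗ[A] P) (d : P →ₗ[A] Q) (hi : Function.Injective i) (hd : Function.Exact i d) :
    Module.Projective A K := by
  have hext : ∀ X Y : ModuleCat.{u} A, extVanish A 3 X Y := by
    have hne : {n : ℕ∞ | ∀ i : ℕ, n < (i : ℕ∞) → ∀ X Y : ModuleCat.{u} A,
        extVanish A i X Y}.Nonempty := by
      by_contra hne
      rw [Set.not_nonempty_iff_eq_empty] at hne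
      simp [globalDim, hne] at hA
    exact csInf_mem hne 3 (lt_of_le_of_lt hA (by norm_num))
  have hP : Projective (ModuleCat.of A P) := (IsProjective.iff_projective _).1 ‹_›
  have hQ : Projective (ModuleCat.of A Q) := (IsProjective.iff_projective _).1 ‹_›
  let S₁ : ShortComplex (ModuleCat.{u} A) := ShortComplex.mk (ModuleCat.ofHom d.range.subtype)
    (ModuleCat.ofHom d.range.mkQ) (by ext x; simp)
  let S₂ : ShortComplex (ModuleCat.{u} A) := ShortComplex.mk (ModuleCat.ofHom i)
    (ModuleCat.ofHom d.rangeRestrict) (by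
      ext x; exact hd.apply_apply_eq_zero x)
  have hS₁ : S₁.ShortExact :=
    { exact := by
        rw [ShortComplex.moduleCat_exact_iff]
        intro x hx
        exact ⟨⟨x, (Submodule.Quotient.mk_eq_zero _).1 hx⟩, rfl⟩
      mono_f := (ModuleCat.mono_iff_injective _).2 Subtype.val_injective
      epi_g := (ModuleCat.epi_iff_surjective _).2 (Submodule.mkQ_surjective _) }
  have hS₂ : S₂.ShortExact :=
    { exact := by
        rw [ShortComplex.moduleCat_exact_iff]
        intro x hx
        exact (hd x).1 (congrArg Subtype.val hx)
      mono_f := (ModuleCat.mono_iff_injective _).2 hi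
      epi_g := (ModuleCat.epi_iff_surjective _).2 d.surjective_rangeRestrict }
  have h3 := hasProjectiveDimensionLT_three S₁.X₃ (hext _)
  have h2 := (hS₁.hasProjectiveDimensionLT_X₃_iff 1 hQ).1 h3
  have h1 := (hS₂.hasProjectiveDimensionLT_X₃_iff 0 hP).1 h2
  exact (IsProjective.iff_projective _).2 ((projective_iff_hasProjectiveDimensionLT_one).2 h1)

/-- A version of `projective_of_globalDim_le_two` up to an isomorphism of rings. -/
lemma projective_of_ringEquiv_of_globalDim_le_two {A B : Type u} [Ring A] [Ring B] (e : A ≃+* B)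
    (hB : globalDim B ≤ 2)
    {K P Q : Type u} [AddCommGroup K] [Module A K] [AddCommGroup P] [Module A P]
    [AddCommGroup Q] [Module A Q] [Module.Projective A P] [Module.Projective A Q]
    (i : K →ₗ[A] P) (d : P →ₗ[A] Q) (hi : Function.Injective i) (hd : Function.Exact i d) :
    Module.Projective A K := by
  let := RingHomInvPair.of_ringEquiv e
  let := RingHomInvPair.of_ringEquiv e.symm
  let mK : Module B K := Module.compHom K (e.symm : B →+* A)
  let mP : Module B P := Module.compHom P (e.symm : B →+* A)
  let mQ : Module B Q := Module.compHom Q (e.symm : B →+* A)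
  have hsmul {N : Type u} [AddCommGroup N] [Module A N] (a : A) (x : N) :
      a • x = (e.symm (e a)) • x := by rw [e.symm_apply_apply]
  let εK : K ≃ₛₗ[(e : A →+* B)] K := { AddEquiv.refl K with map_smul' := fun a x => hsmul a x }
  let εP : P ≃ₛₗ[(e : A →+* B)] P := { AddEquiv.refl P with map_smul' := fun a x => hsmul a x }
  let εQ : Q ≃ₛₗ[(e : A →+* B)] Q := { AddEquiv.refl Q with map_smul' := fun a x => hsmul a x }
  have : Module.Projective B P := Module.Projective.of_equiv εP
  have : Module.Projective B Q := Module.Projective.of_equiv εQ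
  let i' : K →ₗ[B] P := { i with map_smul' := fun b x => i.map_smul (e.symm b) x }
  let d' : P →ₗ[B] Q := { d with map_smul' := fun b x => d.map_smul (e.symm b) x }
  have : Module.Projective B K := projective_of_globalDim_le_two hB i' d' hi hd
  exact Module.Projective.of_equiv εK.symm

/-- Localizing an algebra at a submonoid of units does not change the ring. -/
noncomputable def localizedModuleRingEquiv {R L : Type u} [CommRing R] [Ring L] [Algebra R L] (S : Submonoid R)
    (hS : ∀ s ∈ S, IsUnit s) : L ≃+* LocalizedModule S L :=
  RingEquiv.ofBijective
    ({ toFun := fun x => LocalizedModule.mk x 1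
       map_one' := OreLocalization.one_def.symm
       map_mul' := fun x y => by rw [LocalizedModule.mk_mul_mk, one_mul]
       map_zero' := LocalizedModule.zero_mk 1
       map_add' := fun x y => by simp } : L →+* LocalizedModule S L) (by
    constructor
    · intro x y hxy
      obtain ⟨u, hu⟩ := LocalizedModule.mk_eq.1 hxy
      simp only [one_smul] at hu
      obtain ⟨v, hv⟩ := (hS u u.2)
      have hu' : v • x = v • y := by
        simpa only [Units.smul_def, hv, Submonoid.smul_def] using hu
      exact smul_left_cancel v hu'
    · intro y
      induction y using LocalizedModule.induction_on with
      | h m s =>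
        obtain ⟨v, hv⟩ := (hS s s.2)
        refine ⟨(↑v⁻¹ : R) • m, LocalizedModule.mk_eq.2 ⟨1, ?_⟩⟩
        simp only [one_smul, Submonoid.smul_def, ← hv, smul_smul, Units.mul_inv])

/-- A non-singular order over a two-dimensional local ring has global dimension two. -/
lemma IsNonsingularOrder.globalDim_localizedModule_le {R : Type u} [CommRing R] [IsLocalRing R]
    (hd : ringKrullDim R = 2) {L : Type u} [Ring L] [Algebra R L] (hL : IsNonsingularOrder R L) :
    globalDim (LocalizedModule (maximalIdeal R).primeCompl L) ≤ 2 := by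
  have h := hL.gldim (maximalIdeal R) inferInstance
  have h2 : ringKrullDim (Localization.AtPrime (maximalIdeal R)) = 2 := by
    rw [IsLocalization.AtPrime.ringKrullDim_eq_height (maximalIdeal R),
      IsLocalRing.maximalIdeal_height_eq_ringKrullDim, hd]
  rw [h2] at h
  exact (WithBot.coe_injective h).le

section Reflexive

variable {R : Type u} [CommRing R]

/-- Homomorphisms between finitely generated modules over a Noetherian ring form a finitely
generated module. -/
lemma finite_linearMap_of_isNoetherianRing [IsNoetherianRing R] {M N : Type*} [AddCommGroup M]
    [Module R M] [AddCommGroup N] [Module R N] [Module.Finite R M] [Module.Finite R N] :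
    Module.Finite R (M →ₗ[R] N) := by
  obtain ⟨n, p, hp⟩ := Module.Finite.exists_fin' R M
  exact Module.Finite.of_injective (LinearMap.lcomp R N p)
    (LinearMap.lcomp_injective_of_surjective p hp)

/-- A finite product of copies of a reflexive module is reflexive. -/
lemma isReflexive_pi {ι M : Type*} [Finite ι] [AddCommGroup M] [Module R M]
    [Module.IsReflexive R M] : Module.IsReflexive R (ι → M) where
  bijective_dual_eval' := by
    have := Fintype.ofFinite ι
    constructor
    · rw [injective_iff_map_eq_zero]
      intro x hx
      funext i
      apply (Module.bijective_dual_eval R M).1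
      ext f
      simpa using LinearMap.congr_fun hx (f ∘ₗ LinearMap.proj i)
    · intro θ
      refine ⟨fun i => (Module.evalEquiv R M).symm
        (θ ∘ₗ LinearMap.lcomp R R (LinearMap.proj i)), ?_⟩
      ext g
      have hg : g = ∑ i, (g ∘ₗ LinearMap.single R (fun _ => M) i) ∘ₗ LinearMap.proj i := by
        ext i x
        simp [Pi.single_apply, apply_ite]
      conv_rhs => rw [hg, map_sum]
      rw [Module.Dual.eval_apply]
      conv_lhs => rw [hg]
      simp only [LinearMap.sum_apply, LinearMap.comp_apply, LinearMap.proj_apply]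
      refine Finset.sum_congr rfl fun i _ => ?_
      exact Module.apply_evalEquiv_symm_apply R M (g ∘ₗ LinearMap.single R (fun _ => M) i) _

lemma exists_dual_apply_ne_zero {X : Type*} [AddCommGroup X] [Module R X] [Module.IsReflexive R X]
    {x : X} (hx : x ≠ 0) : ∃ f : Module.Dual R X, f x ≠ 0 := by
  by_contra! h
  exact hx ((Module.bijective_dual_eval R X).1 (by ext f; simpa using h f))

variable [IsDomain R]

lemma exists_smul_eq_of_forall_dvd {N : Type*} [AddCommGroup N] [Module R N] {a : R} (ha : a ≠ 0)
    (θ : Module.Dual R N) (h : ∀ x, a ∣ θ x) : ∃ θ' : Module.Dual R N, ∀ x, θ x = a * θ' x := by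
  choose q hq using h
  refine ⟨{ toFun := q, map_add' := fun x y => ?_, map_smul' := fun r x => ?_ }, hq⟩
  · apply mul_left_cancel₀ ha
    rw [← hq, map_add, mul_add, ← hq, ← hq]
  · apply mul_left_cancel₀ ha
    rw [← hq, map_smul, smul_eq_mul, smul_eq_mul, hq x, RingHom.id_apply]
    ring

variable [IsNoetherianRing R] [IsIntegrallyClosed R]

/-- The trace ideal of a nonzero reflexive module over a normal domain has grade at least two. -/
lemma dvd_of_forall_dvd_mul_dual {M : Type u} [AddCommGroup M] [Module R M]
    [Nontrivial M] [Module.Finite R M] [Module.IsReflexive R M] {a v : R} (ha : a ≠ 0)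
    (h : ∀ (f : Module.Dual R M) (m : M), a ∣ v * f m) : a ∣ v := by
  let K := FractionRing R
  have hfin : Module.Finite R (Module.Dual R M) := finite_linearMap_of_isNoetherianRing
  let φ : Module.Dual R M →ₗ[R] (M →ₗ[R] K) := (Algebra.linearMap R K).compRight R
  have haK : algebraMap R K a ≠ 0 := by simpa [K] using ha
  let q : K := algebraMap R K v / algebraMap R K a
  have hq : IsIntegral R q := by
    refine isIntegral_of_smul_mem_submodule φ.range ?_ ?_ q ?_
    · obtain ⟨m, hm⟩ := exists_ne (0 : M)
      obtain ⟨f, hf⟩ := exists_dual_apply_ne_zero (R := R) hm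
      intro h0
      have h1 : φ f = 0 := by
        have : φ f ∈ φ.range := ⟨f, rfl⟩
        rwa [h0, Submodule.mem_bot] at this
      exact hf (by simpa [φ, K] using LinearMap.congr_fun h1 m)
    · exact Module.Finite.iff_fg.1 inferInstance
    · rintro _ ⟨f, rfl⟩
      obtain ⟨g, hg⟩ := exists_smul_eq_of_forall_dvd ha (v • f) (fun m => h f m)
      refine ⟨g, ?_⟩
      ext m
      have := congrArg (algebraMap R K) (hg m)
      simp only [LinearMap.smul_apply, smul_eq_mul, map_mul] at this
      simp only [φ, q, LinearMap.compRight_apply, LinearMap.comp_apply, LinearMap.smul_apply,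
        Algebra.linearMap_apply, smul_eq_mul]
      rw [div_mul_eq_mul_div, this, mul_div_cancel_left₀ _ haK]
  obtain ⟨r, hr⟩ := IsIntegrallyClosed.isIntegral_iff.1 hq
  refine ⟨r, IsFractionRing.injective R K ?_⟩
  rw [map_mul, hr, mul_div_cancel₀ _ haK]

variable {M : Type u} [AddCommGroup M] [Module R M] [Nontrivial M] [Module.Finite R M]
  [Module.IsReflexive R M]

lemma exists_eq_smul_of_forall_dual {B : Type u} [AddCommGroup B] [Module R B]
    [Module.IsReflexive R B] {a : R} (ha : a ≠ 0) {y : B}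
    (h : ∀ (f : Module.Dual R M) (m : M), ∃ w : B, f m • y = a • w) : ∃ z : B, y = a • z := by
  obtain ⟨θ, hθ⟩ := exists_smul_eq_of_forall_dvd ha (Module.Dual.eval R B y) (fun g => by
    refine dvd_of_forall_dvd_mul_dual (M := M) ha fun f m => ?_
    obtain ⟨w, hw⟩ := h f m
    refine ⟨g w, ?_⟩
    have := congrArg g hw
    rw [map_smul, map_smul, smul_eq_mul, smul_eq_mul] at this
    rw [← this, mul_comm, Module.Dual.eval_apply])
  refine ⟨(Module.evalEquiv R B).symm θ, (Module.bijective_dual_eval R B).1 ?_⟩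
  ext g
  rw [hθ g, map_smul]
  simp

lemma exists_dual_apply_ne_zero_of_nontrivial (R : Type u) [CommRing R] [IsDomain R]
    (M : Type u) [AddCommGroup M] [Module R M] [Nontrivial M] [Module.IsReflexive R M] :
    ∃ (f : Module.Dual R M) (m : M), f m ≠ 0 := by
  obtain ⟨m, hm⟩ := exists_ne (0 : M)
  obtain ⟨f, hf⟩ := exists_dual_apply_ne_zero (R := R) hm
  exact ⟨f, m, hf⟩

/-- The functor `Hom(M, -)` is full on reflexive modules. -/
lemma exists_comp_eq {A B : Type u} [AddCommGroup A] [Module R A] [AddCommGroup B] [Module R B]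
    [Module.IsReflexive R A] [Module.IsReflexive R B]
    (φ : (M →ₗ[R] A) →+ (M →ₗ[R] B))
    (hφ : ∀ (h : M →ₗ[R] A) (e : Module.End R M), φ (h ∘ₗ e) = φ h ∘ₗ e) :
    ∃ ψ : A →ₗ[R] B, ∀ h, φ h = ψ ∘ₗ h := by
  obtain ⟨f₀, m₀, ha⟩ := exists_dual_apply_ne_zero_of_nontrivial R M
  have key (x : A) (f g : Module.Dual R M) (m : M) :
      f m • φ (g.smulRight x) = g.smulRight (φ (f.smulRight x) m) := by
    have h1 : f m • φ (g.smulRight x) = φ (g.smulRight x) ∘ₗ (f m • LinearMap.id) := by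
      ext; simp
    have h2 : g.smulRight x ∘ₗ (f m • LinearMap.id) = f.smulRight x ∘ₗ g.smulRight m := by
      ext; simp [mul_comm]
    rw [h1, ← hφ, h2, hφ]
    ext; simp
  have hex (x : A) : ∃ z : B, ∀ g : Module.Dual R M, φ (g.smulRight x) = g.smulRight z := by
    obtain ⟨z, hz⟩ := exists_eq_smul_of_forall_dual (M := M) (B := B) ha
      (y := φ (f₀.smulRight x) m₀) (fun f m => ⟨φ (f.smulRight x) m, by
        simpa using LinearMap.congr_fun (key x f f₀ m) m₀⟩)
    refine ⟨z, fun g => ?_⟩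
    have h := key x f₀ g m₀
    rw [hz] at h
    ext m
    apply smul_right_injective B ha
    simpa [smul_smul, mul_comm] using LinearMap.congr_fun h m
  choose ψ hψ using hex
  have huniq {y z : B} (h : f₀.smulRight y = f₀.smulRight z) : y = z :=
    smul_right_injective B ha (by simpa using LinearMap.congr_fun h m₀)
  refine ⟨{ toFun := ψ, map_add' := fun x y => huniq ?_, map_smul' := fun r x => huniq ?_ }, ?_⟩
  · rw [← hψ]
    have : f₀.smulRight (x + y) = f₀.smulRight x + f₀.smulRight y := by ext; simp
    rw [this, map_add, hψ, hψ]
    ext; simp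
  · rw [← hψ]
    have : f₀.smulRight (r • x) = f₀.smulRight x ∘ₗ (r • LinearMap.id) := by
      ext; simp [smul_smul, mul_comm]
    rw [this, hφ, hψ]
    ext; simp [smul_smul, mul_comm]
  · intro h
    ext m
    apply smul_right_injective B ha
    have h1 : h ∘ₗ f₀.smulRight m = f₀.smulRight (h m) := by ext; simp
    have h2 := LinearMap.congr_fun ((hφ h (f₀.smulRight m)).symm.trans
      ((congrArg φ h1).trans (hψ (h m) f₀))) m₀
    simpa using h2

/-- Biduality with respect to `M`: an `End(M)`-linear map `Hom(X, M) → M` is given by evaluation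
at an element of the reflexive module `X`. -/
lemma exists_forall_apply_eq {X : Type u} [AddCommGroup X] [Module R X]
    [Module.IsReflexive R X] (Φ : (X →ₗ[R] M) →ₗ[R] M)
    (hΦ : ∀ (e : Module.End R M) (h : X →ₗ[R] M), Φ (e ∘ₗ h) = e (Φ h)) :
    ∃ x : X, ∀ h, Φ h = h x := by
  obtain ⟨f₀, m₀, ha⟩ := exists_dual_apply_ne_zero_of_nontrivial R M
  have key (f : Module.Dual R X) (g : Module.Dual R M) (m m' : M) :
      g m • Φ (f.smulRight m') = g (Φ (f.smulRight m)) • m' := by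
    rw [← map_smul]
    have : g m • f.smulRight m' = g.smulRight m' ∘ₗ f.smulRight m := by
      ext; simp [smul_smul, mul_comm]
    rw [this, hΦ]
    simp
  let u : Module.Dual R (Module.Dual R X) :=
    { toFun := fun f => f₀ (Φ (f.smulRight m₀))
      map_add' := fun f g => by
        rw [← map_add, ← map_add]; congr 2; ext; simp [add_smul]
      map_smul' := fun r f => by
        rw [← map_smul, ← map_smul]; congr 2; ext; simp [smul_smul] }
  obtain ⟨θ, hθ⟩ := exists_smul_eq_of_forall_dvd ha u (fun f =>
    dvd_of_forall_dvd_mul_dual (M := M) ha fun g m => ⟨g (Φ (f.smulRight m)), by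
      have := congrArg f₀ (key f g m m₀)
      simp only [map_smul, smul_eq_mul] at this
      rw [mul_comm, mul_comm (f₀ m₀)]
      exact this⟩)
  let x := (Module.evalEquiv R X).symm θ
  have hx (f : Module.Dual R X) : θ f = f x := by simp [x]
  have hsm (f : Module.Dual R X) (m : M) : Φ (f.smulRight m) = f x • m := by
    apply smul_right_injective M ha
    change f₀ m₀ • _ = f₀ m₀ • _
    rw [key f f₀ m₀ m, smul_smul, ← hx, ← hθ]
    rfl
  refine ⟨x, fun h => (Module.bijective_dual_eval R M).1 ?_⟩
  ext g
  have h1 : g.smulRight m₀ ∘ₗ h = (g ∘ₗ h).smulRight m₀ := by ext; simp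
  have h2 := hΦ (g.smulRight m₀) h
  rw [h1, hsm] at h2
  have h3 := congrArg f₀ h2
  simp only [LinearMap.smulRight_apply, map_smul, smul_eq_mul] at h3
  exact (mul_right_cancel₀ ha h3).symm

variable (M) in
/-- Over a normal domain every finitely generated reflexive module `X` is the kernel of a map
`Mᵃ → Mᵇ`, where `M` is a given nonzero reflexive module. -/
lemma exists_copresentation {X : Type u} [AddCommGroup X] [Module R X]
    [Module.Finite R X] [Module.IsReflexive R X] :
    ∃ (a b : ℕ) (h : Fin a → X →ₗ[R] M) (e : Fin b → Fin a → Module.End R M),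
      (∀ x y, (∀ i, h i x = h i y) → x = y) ∧
      (∀ j x, ∑ i, e j i (h i x) = 0) ∧
      ∀ m : Fin a → M, (∀ j, ∑ i, e j i (m i) = 0) → ∃ x, ∀ i, h i x = m i := by
  have : Module.Finite R (X →ₗ[R] M) := finite_linearMap_of_isNoetherianRing
  have : Module.Finite R (Module.End R M) := finite_linearMap_of_isNoetherianRing
  obtain ⟨a, h, hh⟩ := Module.Finite.exists_fin (R := R) (M := X →ₗ[R] M)
  let L : (Fin a → Module.End R M) →ₗ[R] (X →ₗ[R] M) :=
    ∑ i, LinearMap.lcomp R M (h i) ∘ₗ LinearMap.proj i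
  have hL (e) (x) : L e x = ∑ i, e i (h i x) := by simp [L]
  have hLs (i) (e : Module.End R M) : L (Pi.single i e) = e ∘ₗ h i := by
    ext x
    rw [hL, Finset.sum_eq_single i] <;> simp +contextual
  have hsurj : Function.Surjective L := by
    rw [← LinearMap.range_eq_top, eq_top_iff, ← hh, Submodule.span_le]
    rintro _ ⟨i, rfl⟩
    exact ⟨Pi.single i LinearMap.id, hLs i _⟩
  obtain ⟨b, e, he⟩ := Module.Finite.exists_fin (R := R) (M := L.ker)
  refine ⟨a, b, h, fun j => (e j : Fin a → Module.End R M), fun x y hxy => ?_, fun j x => ?_,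
    fun m hm => ?_⟩
  · obtain ⟨f₀, m₀, ha⟩ := exists_dual_apply_ne_zero_of_nontrivial R M
    refine (Module.bijective_dual_eval R X).1 ?_
    ext f
    obtain ⟨c, hc⟩ := hsurj (f.smulRight m₀)
    have h1 : f.smulRight m₀ x = f.smulRight m₀ y := by
      rw [← hc, hL, hL]; simp [hxy]
    have h2 := congrArg f₀ h1
    simp only [LinearMap.smulRight_apply, map_smul, smul_eq_mul] at h2
    exact mul_right_cancel₀ ha h2
  · rw [← hL, (e j).2]; rfl
  · let Ψ : (Fin a → Module.End R M) →ₗ[R] M :=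
      ∑ i, LinearMap.applyₗ (m i) ∘ₗ LinearMap.proj i
    have hΨ (c) : Ψ c = ∑ i, c i (m i) := by simp [Ψ]
    have hle : L.ker ≤ Ψ.ker := by
      rw [← Submodule.range_subtype L.ker, LinearMap.range_eq_map, ← he, Submodule.map_span_le]
      rintro _ ⟨j, rfl⟩
      exact (hΨ _).trans (hm j)
    let Φ : (X →ₗ[R] M) →ₗ[R] M :=
      L.ker.liftQ Ψ hle ∘ₗ (L.quotKerEquivOfSurjective hsurj).symm.toLinearMap
    have hΦL (c) : Φ (L c) = Ψ c := by
      have : (L.quotKerEquivOfSurjective hsurj).symm (L c) = L.ker.mkQ c := by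
        rw [LinearEquiv.symm_apply_eq]; rfl
      simp [Φ, this]
    obtain ⟨x, hx⟩ := exists_forall_apply_eq Φ (fun e' g => by
      obtain ⟨c, rfl⟩ := hsurj g
      have : e' ∘ₗ L c = L (fun i => e' ∘ₗ c i) := by
        ext x; simp [hL]
      rw [this, hΦL, hΦL, hΨ, hΨ]
      simp)
    refine ⟨x, fun i => ?_⟩
    have h1 : h i = L (Pi.single i LinearMap.id) := by rw [hLs, LinearMap.id_comp]
    rw [← hx (h i), h1, hΦL, hΨ, Finset.sum_eq_single i] <;> simp +contextual

end Reflexive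

section EndOp

variable {R M X : Type u} [CommRing R] [AddCommGroup M] [Module R M] [AddCommGroup X] [Module R X]

lemma endOp_smul_def (c : (Module.End R M)ᵐᵒᵖ) (h : M →ₗ[R] X) : c • h = h ∘ₗ c.unop := rfl

/-- If `X` is the kernel of a map `Mᵃ → Mᵇ` and `End(M)ᵒᵖ` has global dimension at most two, then
`Hom(M, X)` is projective over `End(M)ᵒᵖ`. -/
lemma projective_hom_of_copresentation {B : Type u} [Ring B] (ε : (Module.End R M)ᵐᵒᵖ ≃+* B)
    (hB : globalDim B ≤ 2) {a b : ℕ} (h : Fin a → X →ₗ[R] M) (e : Fin b → Fin a → Module.End R M)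
    (hinj : ∀ x y, (∀ i, h i x = h i y) → x = y)
    (hcomp : ∀ j x, ∑ i, e j i (h i x) = 0)
    (hex : ∀ m : Fin a → M, (∀ j, ∑ i, e j i (m i) = 0) → ∃ x, ∀ i, h i x = m i) :
    Module.Projective (Module.End R M)ᵐᵒᵖ (M →ₗ[R] X) := by
  let ι : (M →ₗ[R] X) →ₗ[(Module.End R M)ᵐᵒᵖ] (Fin a → (Module.End R M)ᵐᵒᵖ) :=
    { toFun := fun g i => MulOpposite.op (h i ∘ₗ g)
      map_add' := fun g g' => by
        funext i
        simp [LinearMap.comp_add]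
      map_smul' := fun c g => rfl }
  let d : (Fin a → (Module.End R M)ᵐᵒᵖ) →ₗ[(Module.End R M)ᵐᵒᵖ] (Fin b → (Module.End R M)ᵐᵒᵖ) :=
    LinearMap.pi fun j => ∑ i, LinearMap.toSpanSingleton _ _ (MulOpposite.op (e j i)) ∘ₗ
      LinearMap.proj i
  have hd (c : Fin a → (Module.End R M)ᵐᵒᵖ) (j) (m) :
      (d c j).unop m = ∑ i, e j i ((c i).unop m) := by
    simp [d]
  refine projective_of_ringEquiv_of_globalDim_le_two ε hB ι d ?_ ?_
  · intro g g' hg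
    ext m
    exact hinj _ _ fun i => LinearMap.congr_fun (MulOpposite.op_injective (congrFun hg i)) m
  · intro c
    constructor
    · intro hc
      have hc' (m) : ∃ x, ∀ i, h i x = (c i).unop m := hex _ fun j => by
        rw [← hd, hc]; rfl
      choose g hg using hc'
      refine ⟨{ toFun := g, map_add' := fun x y => hinj _ _ fun i => ?_,
                map_smul' := fun r x => hinj _ _ fun i => ?_ }, ?_⟩
      · simp [hg]
      · simp [hg]
      · funext i
        apply MulOpposite.unop_injective
        ext m
        exact hg m i
    · rintro ⟨g, rfl⟩
      funext j
      apply MulOpposite.unop_injective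
      ext m
      rw [hd]
      exact hcomp j (g m)

variable [IsDomain R] [IsNoetherianRing R] [IsIntegrallyClosed R] [Nontrivial M]
  [Module.Finite R M] [Module.IsReflexive R M] [Module.Finite R X] [Module.IsReflexive R X]

/-- A reflexive module `X` with `Hom(M, X)` projective over `End(M)ᵒᵖ` lies in `add M`. -/
lemma inAdd_of_projective_hom (hX : Module.Projective (Module.End R M)ᵐᵒᵖ (M →ₗ[R] X)) :
    InAdd R M X := by
  have : Module.Finite R (M →ₗ[R] X) := finite_linearMap_of_isNoetherianRing
  obtain ⟨n, p, hp⟩ := Module.Finite.exists_fin (R := R) (M := M →ₗ[R] X)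
  let π : (Fin n → (Module.End R M)ᵐᵒᵖ) →ₗ[(Module.End R M)ᵐᵒᵖ] (M →ₗ[R] X) :=
    ∑ i, LinearMap.toSpanSingleton _ _ (p i) ∘ₗ LinearMap.proj i
  have hπ (c) (m : M) : π c m = ∑ i, p i ((c i).unop m) := by
    simp [π, endOp_smul_def]
  have hsurj : Function.Surjective π := by
    intro g
    have hg : g ∈ Submodule.span R (Set.range p) := hp ▸ Submodule.mem_top
    obtain ⟨c, rfl⟩ := (Submodule.mem_span_range_iff_exists_fun R).1 hg
    refine ⟨fun i => MulOpposite.op (c i • LinearMap.id), ?_⟩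
    ext m
    rw [hπ]
    simp
  obtain ⟨σ, hσ⟩ := Module.projective_lifting_property π LinearMap.id hsurj
  have hψ (i) : ∃ ψ : X →ₗ[R] M, ∀ g, (σ g i).unop = ψ ∘ₗ g :=
    exists_comp_eq
      { toFun := fun g => (σ g i).unop
        map_zero' := by simp
        map_add' := fun g g' => by simp }
      (fun g e => by
        have := congrFun (σ.map_smul (MulOpposite.op e) g) i
        exact congrArg MulOpposite.unop this)
  choose ψ hψ using hψ
  refine ⟨n, LinearMap.pi ψ, ∑ i, p i ∘ₗ LinearMap.proj i, ?_⟩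
  obtain ⟨f₀, m₀, ha⟩ := exists_dual_apply_ne_zero_of_nontrivial R M
  ext x
  have h1 := LinearMap.congr_fun (LinearMap.congr_fun hσ (f₀.smulRight x)) m₀
  rw [LinearMap.comp_apply, hπ] at h1
  simp only [hψ] at h1
  apply smul_right_injective X ha
  simpa [Finset.smul_sum] using h1

end EndOp

/-- in dimension two, `add M` is all of `ref R`. -/
theorem stmt10 (R : Type u) [CommRing R] [IsLocalRing R] [IsNoetherianRing R]
    [IsDomain R] [IsIntegrallyClosed R]
    (hCM : IsCMLocalRing R) (hd : ringKrullDim R = 2)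
    (w : Type u) [AddCommGroup w] [Module R w] (hw : IsCanonicalModule R w)
    (M : Type u) [AddCommGroup M] [Module R M] (hM : IsNCCR R M) :
    ∀ (X : Type u) [AddCommGroup X] [Module R X],
      (Module.Finite R X ∧ Module.IsReflexive R X) ↔ InAdd R M X := by
  intro X _ _
  obtain ⟨_, _, _, hord⟩ := hM
  constructor
  · rintro ⟨_, _⟩
    obtain ⟨a, b, h, e, hinj, hcomp, hex⟩ := exists_copresentation (R := R) M (X := X)
    have hunit : ∀ s ∈ (maximalIdeal R).primeCompl, IsUnit s := fun s hs =>
      IsLocalRing.notMem_maximalIdeal.1 hs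
    exact inAdd_of_projective_hom (projective_hom_of_copresentation
      (localizedModuleRingEquiv _ hunit) (hord.globalDim_localizedModule_le hd) h e hinj hcomp hex)
  · rintro ⟨n, s, r, hrs⟩
    have : Module.IsReflexive R (Fin n → M) := isReflexive_pi
    exact ⟨Module.Finite.of_surjective r (LinearMap.surjective_of_comp_eq_id s r hrs),
      Module.IsReflexive.of_split s r hrs⟩
end
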